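/- arXiv:2108.00987 — 2 statements merged into one kernel-verified Lean document; each statement's English description precedes it below -/
import Mathlib

section
/- For any 0 < ε < 10^{-20} there is a constant M_0 = M_0(ε) such that, setting α = 20√ε, for all n sufficiently large in terms of ε, any two-coloring of the edges of the complete graph K_n in red and blue falls into one of the following two cases. Case 1: there is an integer M with ε^{-1} ≤ M ≤ M_0 such that, if t is the odd integer with (1/2 + α)M ≥ t > (1/2 + α)M − 2, then there are disjoint vertex sets V_0, …, V_{t−1}, indexed by the elements of Z/tZ, and a color χ such that for each i ∈ Z/tZ: |V_i| ≥ ⌊n/M⌋, the pair (V_i, V_{i+1}) is ε-regular in the subgraph of edges of color χ, and the edge density between V_i and V_{i+1} in the color χ is at least 11ε^{1/2}. Case 2: the coloring is an extremal coloring with parameter 300√α. -/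
open Finset
open scoped Classical

noncomputable section

/-- Number of ordered pairs `(x, y) ∈ X × Y` that are adjacent in `G`.  For disjoint `X`, `Y`
this is the number `e(X, Y)` of edges between `X` and `Y`. -/
def interPairs {V : Type*} (G : SimpleGraph V) (X Y : Finset V) : ℕ :=
  ((X ×ˢ Y).filter fun p => G.Adj p.1 p.2).card

/-- The edge density `d(X, Y) = e(X, Y) / (|X| |Y|)` between disjoint sets `X` and `Y`. -/
def dens {V : Type*} (G : SimpleGraph V) (X Y : Finset V) : ℝ :=
  (interPairs G X Y : ℝ) / ((X.card : ℝ) * (Y.card : ℝ))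

/-- The density `2 e(X) / |X| ^ 2` of a vertex set `X`. -/
def densIn {V : Type*} (G : SimpleGraph V) (X : Finset V) : ℝ :=
  (interPairs G X X : ℝ) / ((X.card : ℝ) ^ 2)

/-- `(X, Y)` is an `ε`-regular pair: for all `U ⊆ X`, `W ⊆ Y` with `|U| ≥ ε |X|` and
`|W| ≥ ε |Y|` we have `|d(U, W) - d(X, Y)| ≤ ε`. -/
def IsRegularPair {V : Type*} (G : SimpleGraph V) (ε : ℝ) (X Y : Finset V) : Prop :=
  ∀ U ⊆ X, ∀ W ⊆ Y, ε * X.card ≤ (U.card : ℝ) → ε * Y.card ≤ (W.card : ℝ) →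
    |dens G U W - dens G X Y| ≤ ε

/-- The graph of a color: a two-coloring of `K_n` is given by its red graph `R`; color
`true` is red and color `false` is blue (the complement `Rᶜ`). -/
def colorGraph {V : Type*} (R : SimpleGraph V) (χ : Bool) : SimpleGraph V :=
  if χ then R else Rᶜ

/-- A two-coloring of the edges of the complete graph on `n` vertices (given by its red graph
`R`, the blue graph being `Rᶜ`) is an extremal coloring with parameter `lam` if there is a
partition `A ∪ B` of the vertex set with `|A|, |B| ≥ (1/2 - lam) n` such that `A` and `B` both
have density at least `1 - lam` in one color and the bipartite graph between `A` and `B` has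
density at least `1 - lam` in the other color. -/
def IsExtremalColoring {n : ℕ} (R : SimpleGraph (Fin n)) (lam : ℝ) : Prop :=
  ∃ A B : Finset (Fin n), Disjoint A B ∧ A ∪ B = Finset.univ ∧
    (1 / 2 - lam) * n ≤ (A.card : ℝ) ∧ (1 / 2 - lam) * n ≤ (B.card : ℝ) ∧
    ((1 - lam ≤ densIn R A ∧ 1 - lam ≤ densIn R B ∧ 1 - lam ≤ dens Rᶜ A B) ∨
     (1 - lam ≤ densIn Rᶜ A ∧ 1 - lam ≤ densIn Rᶜ B ∧ 1 - lam ≤ dens R A B))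

section EdgeCounts

variable {V : Type*} (G : SimpleGraph V)

lemma interPairs_eq_sum (X Y : Finset V) :
    interPairs G X Y = ∑ x ∈ X, (Y.filter (G.Adj x)).card := by
  rw [interPairs, Finset.card_filter, Finset.sum_product]
  exact Finset.sum_congr rfl fun x _ => (Finset.card_filter _ _).symm

lemma interPairs_comm (X Y : Finset V) : interPairs G X Y = interPairs G Y X := by
  rw [interPairs, interPairs, Finset.card_filter, Finset.card_filter, Finset.sum_product,
    Finset.sum_product_right]
  simp only [G.adj_comm]

lemma dens_comm (X Y : Finset V) : dens G X Y = dens G Y X := by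
  unfold _root_.dens
  rw [interPairs_comm, mul_comm]

lemma interPairs_le_mul (X Y : Finset V) : interPairs G X Y ≤ X.card * Y.card := by
  rw [← Finset.card_product]
  exact Finset.card_filter_le _ _

lemma interPairs_union_left [DecidableEq V] {X X' : Finset V} (h : Disjoint X X') (Y : Finset V) :
    interPairs G (X ∪ X') Y = interPairs G X Y + interPairs G X' Y := by
  simp only [interPairs_eq_sum, Finset.sum_union h]

lemma interPairs_union_right [DecidableEq V] {Y Y' : Finset V} (X : Finset V) (h : Disjoint Y Y') :
    interPairs G X (Y ∪ Y') = interPairs G X Y + interPairs G X Y' := by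
  rw [interPairs_comm, interPairs_union_left G h, interPairs_comm G Y, interPairs_comm G Y']

/-- The ordered adjacent pairs split along a partition of the vertex set into two parts. -/
lemma interPairs_univ_split [Fintype V] [DecidableEq V] (A : Finset V) :
    interPairs G univ univ =
      interPairs G A A + interPairs G Aᶜ Aᶜ + 2 * interPairs G A Aᶜ := by
  have h : Disjoint A Aᶜ := disjoint_compl_right
  rw [← Finset.union_compl A, interPairs_union_left G h, interPairs_union_right G _ h,
    interPairs_union_right G _ h, interPairs_comm G Aᶜ A]
  ring

lemma interPairs_add_compl {X Y : Finset V} (h : Disjoint X Y) :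
    interPairs G X Y + interPairs Gᶜ X Y = X.card * Y.card := by
  rw [← Finset.card_product, interPairs, interPairs, Finset.card_filter, Finset.card_filter,
    ← Finset.sum_add_distrib, Finset.card_eq_sum_ones]
  refine Finset.sum_congr rfl fun p hp => ?_
  rw [Finset.mem_product] at hp
  have hne := Finset.disjoint_iff_ne.1 h _ hp.1 _ hp.2
  by_cases h' : G.Adj p.1 p.2 <;> simp [SimpleGraph.compl_adj, hne, h']

lemma interPairs_self_add_compl (X : Finset V) :
    interPairs G X X + interPairs Gᶜ X X + X.card = X.card * X.card := by
  have hd : ((X ×ˢ X).filter fun p => p.1 = p.2).card = X.card := by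
    rw [show ((X ×ˢ X).filter fun p => p.1 = p.2) = X.diag from ?_, Finset.diag_card]
    ext ⟨a, b⟩
    simp only [Finset.mem_filter, Finset.mem_product, Finset.mem_diag]
    constructor
    · rintro ⟨⟨h, -⟩, rfl⟩
      exact ⟨h, rfl⟩
    · rintro ⟨h, rfl⟩
      exact ⟨⟨h, h⟩, rfl⟩
  rw [Finset.card_filter] at hd
  rw [← Finset.card_product, interPairs, interPairs, Finset.card_filter, Finset.card_filter]
  refine (congrArg _ hd.symm).trans ?_
  rw [← Finset.sum_add_distrib, ← Finset.sum_add_distrib, Finset.card_eq_sum_ones]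
  refine Finset.sum_congr rfl fun p _ => ?_
  by_cases h : p.1 = p.2
  · simp [h]
  · by_cases h' : G.Adj p.1 p.2 <;> simp [SimpleGraph.compl_adj, h, h']

lemma dens_eq_edgeDensity (X Y : Finset V) : dens G X Y = (G.edgeDensity X Y : ℝ) := by
  unfold _root_.dens
  rw [SimpleGraph.edgeDensity_def, interPairs, SimpleGraph.interedges_def]
  push_cast
  congr

lemma IsRegularPair.symm {ε : ℝ} {X Y : Finset V} {G : SimpleGraph V}
    (h : IsRegularPair G ε X Y) : IsRegularPair G ε Y X := by
  intro U hU W hW hUc hWc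
  rw [dens_comm G U, dens_comm G Y]
  exact h W hW U hU hWc hUc

end EdgeCounts

section Clusters

variable {α : Type*} [Fintype α] {k : ℕ}

/-- The class of vertices with label `i`. -/
def cluster (c : α → Fin k) (i : Fin k) : Finset α := univ.filter fun x => c x = i

lemma mem_cluster {c : α → Fin k} {i : Fin k} {x : α} : x ∈ cluster c i ↔ c x = i := by
  simp [cluster]

lemma disjoint_cluster (c : α → Fin k) {i j : Fin k} (h : i ≠ j) :
    Disjoint (cluster c i) (cluster c j) := by
  rw [Finset.disjoint_left]
  intro x hx hy
  rw [mem_cluster] at hx hy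
  exact h (hx.symm.trans hy)

/-- A labelling whose classes are almost equal and almost all pairwise `ε`-regular. -/
structure IsRegularLabelling (G : SimpleGraph α) (ε : ℝ) (c : α → Fin k) : Prop where
  le_card : ∀ i, Fintype.card α / k ≤ (cluster c i).card
  card_le : ∀ i, (cluster c i).card ≤ Fintype.card α / k + 1
  irregular : (((univ : Finset (Fin k × Fin k)).filter fun p =>
    p.1 ≠ p.2 ∧ ¬IsRegularPair G ε (cluster c p.1) (cluster c p.2)).card : ℝ) ≤ ε * k ^ 2

theorem exists_isRegularLabelling [DecidableEq α] (G : SimpleGraph α) {ε : ℝ} (hε : 0 < ε) {l : ℕ}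
    (hl : l ≤ Fintype.card α) :
    ∃ k, l ≤ k ∧ k ≤ SzemerediRegularity.bound ε l ∧
      ∃ c : α → Fin k, IsRegularLabelling G ε c := by
  obtain ⟨P, hP, hlP, hPb, hu⟩ := szemeredi_regularity G hε hl
  let e := P.parts.equivFin
  let c : α → Fin P.parts.card := fun x => e ⟨P.part x, P.part_mem.2 (mem_univ x)⟩
  have hc : ∀ s : P.parts, cluster c (e s) = s.1 := by
    intro s
    ext x
    rw [mem_cluster, e.apply_eq_iff_eq, Subtype.ext_iff]
    constructor
    · intro h
      rw [← h]
      exact P.mem_part (mem_univ x)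
    · exact fun h => P.part_eq_of_mem s.2 h
  have hc' : ∀ i, cluster c i = (e.symm i).1 := fun i => by
    rw [← hc (e.symm i), e.apply_symm_apply]
  refine ⟨P.parts.card, hlP, hPb, c, ⟨fun i => ?_, fun i => ?_, ?_⟩⟩
  · rw [hc', ← Finset.card_univ]
    exact hP.average_le_card_part (e.symm i).2
  · rw [hc', ← Finset.card_univ]
    exact hP.card_part_le_average_add_one (e.symm i).2
  · have hle : ((univ : Finset (Fin P.parts.card × Fin P.parts.card)).filter fun p =>
        p.1 ≠ p.2 ∧ ¬IsRegularPair G ε (cluster c p.1) (cluster c p.2)).card ≤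
        (P.nonUniforms G ε).card := by
      refine Finset.card_le_card_of_injOn (fun p => ((e.symm p.1).1, (e.symm p.2).1)) ?_ ?_
      · intro p hp
        simp only [Finset.coe_filter, Finset.mem_univ, true_and, Set.mem_ofPred_eq] at hp
        rw [Finset.mem_coe, Finpartition.mk_mem_nonUniforms]
        refine ⟨(e.symm p.1).2, (e.symm p.2).2, ?_, fun hreg => hp.2 ?_⟩
        · intro h
          exact hp.1 (e.symm.injective (Subtype.ext h))
        · intro U hU W hW hUc hWc
          rw [hc'] at hU hUc
          rw [hc'] at hW hWc
          rw [dens_eq_edgeDensity, dens_eq_edgeDensity, hc', hc']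
          exact (hreg hU hW (by rwa [mul_comm]) (by rwa [mul_comm])).le
      · intro p _ p' _ h
        simp only [Prod.mk.injEq] at h
        exact Prod.ext (e.symm.injective (Subtype.ext h.1)) (e.symm.injective (Subtype.ext h.2))
    calc _ ≤ ((P.nonUniforms G ε).card : ℝ) := by exact_mod_cast hle
      _ ≤ (P.parts.card * (P.parts.card - 1) : ℕ) * ε := hu
      _ ≤ (P.parts.card * P.parts.card : ℕ) * ε := by gcongr; omega
      _ = _ := by push_cast; ring

/-- The graph on the labels whose edges are the `ε`-regular pairs of density at least `d`. -/
def reducedGraph (G : SimpleGraph α) (ε d : ℝ) (c : α → Fin k) : SimpleGraph (Fin k) where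
  Adj i j := i ≠ j ∧ IsRegularPair G ε (cluster c i) (cluster c j) ∧
    d ≤ dens G (cluster c i) (cluster c j)
  symm := ⟨fun i j h => ⟨h.1.symm, h.2.1.symm, by rw [dens_comm]; exact h.2.2⟩⟩
  loopless := ⟨fun _ h => h.1 rfl⟩

/-- The union of the classes with label in `A`. -/
def lift (c : α → Fin k) (A : Finset (Fin k)) : Finset α := univ.filter fun x => c x ∈ A

lemma lift_univ (c : α → Fin k) : lift c univ = univ := by
  simp [lift]

lemma lift_compl [DecidableEq α] (c : α → Fin k) (A : Finset (Fin k)) : lift c Aᶜ = (lift c A)ᶜ := by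
  ext
  simp [lift]

lemma sum_lift {M : Type*} [AddCommMonoid M] (c : α → Fin k) (A : Finset (Fin k)) (f : α → M) :
    ∑ x ∈ lift c A, f x = ∑ i ∈ A, ∑ x ∈ cluster c i, f x := by
  rw [← Finset.sum_fiberwise_of_maps_to (s := lift c A) (t := A) (g := c)
    (fun x hx => (Finset.mem_filter.1 hx).2)]
  refine Finset.sum_congr rfl fun i hi => Finset.sum_congr ?_ fun _ _ => rfl
  ext x
  simp only [lift, cluster, Finset.mem_filter, Finset.mem_univ, true_and]
  exact ⟨fun h => h.2, fun h => ⟨h ▸ hi, h⟩⟩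

lemma interPairs_lift (G : SimpleGraph α) (c : α → Fin k) (A B : Finset (Fin k)) :
    interPairs G (lift c A) (lift c B) =
      ∑ p ∈ A ×ˢ B, interPairs G (cluster c p.1) (cluster c p.2) := by
  rw [Finset.sum_product, interPairs_eq_sum, sum_lift]
  refine Finset.sum_congr rfl fun i _ => ?_
  simp only [fun j => interPairs_eq_sum G (cluster c i) (cluster c j)]
  rw [Finset.sum_comm]
  refine Finset.sum_congr rfl fun x _ => ?_
  simp only [Finset.card_filter]
  exact sum_lift c B _

variable {G : SimpleGraph α} {ε d q : ℝ} {c : α → Fin k}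

lemma IsRegularLabelling.card_le_real (h : IsRegularLabelling G ε c) (i : Fin k) :
    ((cluster c i).card : ℝ) ≤ Fintype.card α / k + 1 := by
  have h1 : ((cluster c i).card : ℝ) ≤ ((Fintype.card α / k : ℕ) : ℝ) + 1 := by
    exact_mod_cast h.card_le i
  have h2 : ((Fintype.card α / k : ℕ) : ℝ) ≤ Fintype.card α / k := Nat.cast_div_le
  linarith

lemma IsRegularLabelling.le_card_real (h : IsRegularLabelling G ε c) (i : Fin k) :
    (Fintype.card α : ℝ) / k - 1 ≤ (cluster c i).card := by
  have h1 : ((Fintype.card α / k : ℕ) : ℝ) ≤ ((cluster c i).card : ℝ) := by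
    exact_mod_cast h.le_card i
  have hk : 0 < k := i.pos
  have h2 : (Fintype.card α : ℝ) / k < ((Fintype.card α / k : ℕ) : ℝ) + 1 := by
    rw [div_lt_iff₀ (by exact_mod_cast hk)]
    exact_mod_cast Nat.lt_mul_of_div_lt (Nat.lt_succ_self _) hk
  linarith

lemma IsRegularLabelling.interPairs_lift_le (h : IsRegularLabelling G ε c) (hd : 0 ≤ d)
    (A B : Finset (Fin k)) :
    (interPairs G (lift c A) (lift c B) : ℝ) ≤ ((Fintype.card α : ℝ) / k + 1) ^ 2 *
      (interPairs (reducedGraph G ε d c) A B + ε * k ^ 2 + d * k ^ 2 + k) := by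
  set s : ℝ := (Fintype.card α : ℝ) / k + 1 with hs
  have hs0 : 0 ≤ s := by positivity
  have hterm : ∀ p ∈ A ×ˢ B, (interPairs G (cluster c p.1) (cluster c p.2) : ℝ) ≤
      s ^ 2 * ((if (reducedGraph G ε d c).Adj p.1 p.2 then 1 else 0) +
        (if p.1 ≠ p.2 ∧ ¬IsRegularPair G ε (cluster c p.1) (cluster c p.2) then 1 else 0) +
        d + (if p.1 = p.2 then 1 else 0)) := by
    intro p _
    have h1 := h.card_le_real p.1
    have h2 := h.card_le_real p.2
    have hmul : ((cluster c p.1).card : ℝ) * (cluster c p.2).card ≤ s ^ 2 := by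
      rw [sq]; gcongr
    have htriv : (interPairs G (cluster c p.1) (cluster c p.2) : ℝ) ≤ s ^ 2 := by
      refine le_trans ?_ hmul
      exact_mod_cast interPairs_le_mul _ _ _
    have hbig : ∀ x : ℝ, 1 ≤ x →
        (interPairs G (cluster c p.1) (cluster c p.2) : ℝ) ≤ s ^ 2 * x := fun x hx =>
      htriv.trans (le_mul_of_one_le_right (by positivity) hx)
    by_cases heq : p.1 = p.2
    · apply hbig
      rw [if_pos heq]
      have : (0 : ℝ) ≤ (if (reducedGraph G ε d c).Adj p.1 p.2 then 1 else 0) := by positivity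
      have : (0 : ℝ) ≤ (if p.1 ≠ p.2 ∧ ¬IsRegularPair G ε (cluster c p.1) (cluster c p.2)
        then 1 else 0) := by positivity
      linarith
    by_cases hreg : IsRegularPair G ε (cluster c p.1) (cluster c p.2)
    · by_cases hdens : d ≤ dens G (cluster c p.1) (cluster c p.2)
      · apply hbig
        rw [if_pos (show (reducedGraph G ε d c).Adj p.1 p.2 from ⟨heq, hreg, hdens⟩)]
        simp [heq, hreg, hd]
      · have hdle : (interPairs G (cluster c p.1) (cluster c p.2) : ℝ) ≤ s ^ 2 * d := by
          unfold _root_.dens at hdens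
          rw [not_le] at hdens
          rcases (Nat.cast_nonneg (α := ℝ) ((cluster c p.1).card * (cluster c p.2).card)).eq_or_lt
            with h0 | h0
          · have : (interPairs G (cluster c p.1) (cluster c p.2) : ℝ) ≤ 0 := by
              rw [h0]; exact_mod_cast interPairs_le_mul _ _ _
            exact this.trans (by positivity)
          · push_cast at h0
            rw [div_lt_iff₀ h0] at hdens
            nlinarith
        refine hdle.trans ?_
        gcongr
        have : (0 : ℝ) ≤ (if (reducedGraph G ε d c).Adj p.1 p.2 then 1 else 0) := by positivity
        simp [heq, hreg, this]
    · apply hbig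
      have : (0 : ℝ) ≤ (if (reducedGraph G ε d c).Adj p.1 p.2 then 1 else 0) := by positivity
      rw [if_pos (show p.1 ≠ p.2 ∧ _ from ⟨heq, hreg⟩), if_neg heq]
      linarith
  rw [interPairs_lift]
  push_cast
  refine (Finset.sum_le_sum hterm).trans ?_
  rw [← Finset.mul_sum]
  gcongr
  simp only [Finset.sum_add_distrib]
  have hcard : ((A ×ˢ B).card : ℝ) ≤ (k : ℝ) ^ 2 := by
    have : (A ×ˢ B).card ≤ k ^ 2 := by
      refine (Finset.card_le_univ _).trans ?_
      simp [sq]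
    exact_mod_cast this
  gcongr ?_ + ?_ + ?_ + ?_
  · rw [interPairs, Finset.card_filter]
    push_cast
    rfl
  · refine le_trans ?_ h.irregular
    rw [Finset.card_filter]
    push_cast
    exact Finset.sum_le_sum_of_subset_of_nonneg (Finset.subset_univ _) fun _ _ _ => by positivity
  · rw [Finset.sum_const, nsmul_eq_mul, mul_comm]
    gcongr
  · calc _ ≤ ∑ p : Fin k × Fin k, (if p.1 = p.2 then (1 : ℝ) else 0) :=
        Finset.sum_le_sum_of_subset_of_nonneg (Finset.subset_univ _) fun _ _ _ => by positivity
      _ = k := by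
        rw [Fintype.sum_prod_type]
        simp

/-- Up to a small error, normalised edge counts of a graph are controlled by those of its reduced
graph. -/
lemma IsRegularLabelling.interPairs_lift_le_add (h : IsRegularLabelling G ε c) (hd : 0 ≤ d)
    (hd1 : d ≤ 1) (hq : 0 < q) (hq1 : q ≤ 1) (hε1 : ε ≤ q / 8) (hk : 8 / q ≤ k)
    (hα : 1000 * k / q ≤ Fintype.card α) (A B : Finset (Fin k)) :
    (interPairs G (lift c A) (lift c B) : ℝ) / (Fintype.card α : ℝ) ^ 2 ≤
      interPairs (reducedGraph G ε d c) A B / (k : ℝ) ^ 2 + d + q := by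
  have hk0 : (0 : ℝ) < k := lt_of_lt_of_le (by positivity) hk
  have hN0 : (0 : ℝ) < Fintype.card α := lt_of_lt_of_le (by positivity) hα
  set N : ℝ := (Fintype.card α : ℝ)
  set y : ℝ := interPairs (reducedGraph G ε d c) A B / (k : ℝ) ^ 2 with hy
  have hy1 : y ≤ 1 := by
    rw [hy, div_le_one (by positivity)]
    have h1 := interPairs_le_mul (reducedGraph G ε d c) A B
    have h2 : A.card * B.card ≤ k * k := by
      refine Nat.mul_le_mul ?_ ?_ <;> exact (Finset.card_le_univ _).trans (by simp)
    rw [sq]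
    exact_mod_cast h1.trans h2
  have h1k : 1 / (k : ℝ) ≤ q / 8 := by
    rw [div_le_iff₀ hq] at hk
    rw [div_le_div_iff₀ hk0 (by norm_num)]
    linarith
  have hkN : (k : ℝ) / N ≤ q / 1000 := by
    rw [div_le_iff₀ hq] at hα
    rw [div_le_div_iff₀ hN0 (by norm_num)]
    linarith
  have hkN0 : 0 < (k : ℝ) / N := by positivity
  have key := h.interPairs_lift_le hd A B
  have heq : (N / k + 1) ^ 2 *
      (interPairs (reducedGraph G ε d c) A B + ε * k ^ 2 + d * k ^ 2 + k) =
      N ^ 2 * ((1 + k / N) ^ 2 * (y + ε + d + 1 / k)) := by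
    rw [hy]
    field_simp
  rw [heq] at key
  rw [div_le_iff₀ (by positivity), mul_comm _ (N ^ 2)]
  refine key.trans ?_
  gcongr
  have hy0 : 0 ≤ y := by positivity
  have hz : y + ε + d + 1 / k ≤ y + d + q / 4 := by linarith
  have hsq : (1 + (k : ℝ) / N) ^ 2 ≤ 1 + q / 100 := by nlinarith
  calc _ ≤ (1 + q / 100) * (y + d + q / 4) := by
        apply (mul_le_mul_of_nonneg_left hz (by positivity)).trans
        gcongr
    _ ≤ _ := by nlinarith

/-- `A` and its complement have about half the vertices each, and either few edges cross or few
edges stay inside. -/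
def NearSplit {V : Type*} [Fintype V] [DecidableEq V] (G : SimpleGraph V) (σ τ : ℝ) : Prop :=
  ∃ A : Finset V, (1 / 2 - σ) * Fintype.card V ≤ A.card ∧
    (1 / 2 - σ) * Fintype.card V ≤ (Aᶜ).card ∧
    ((interPairs G A Aᶜ : ℝ) / (Fintype.card V : ℝ) ^ 2 ≤ τ ∨
      ((interPairs G A A : ℝ) / (Fintype.card V : ℝ) ^ 2 ≤ τ ∧
        (interPairs G Aᶜ Aᶜ : ℝ) / (Fintype.card V : ℝ) ^ 2 ≤ τ))

lemma IsRegularLabelling.le_card_lift (h : IsRegularLabelling G ε c) (hq : 0 < q)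
    (hk : 8 / q ≤ k) (hα : 1000 * k / q ≤ Fintype.card α) {σ : ℝ} {A : Finset (Fin k)}
    (hA : (1 / 2 - σ) * k ≤ A.card) :
    (1 / 2 - (σ + q)) * Fintype.card α ≤ (lift c A).card := by
  have hk0 : (0 : ℝ) < k := lt_of_lt_of_le (by positivity) hk
  have hN0 : (0 : ℝ) < Fintype.card α := lt_of_lt_of_le (by positivity) hα
  have h1 : ((lift c A).card : ℝ) = ∑ i ∈ A, ((cluster c i).card : ℝ) := by
    rw [Finset.card_eq_sum_ones, sum_lift]
    push_cast
    simp
  have h2 : (A.card : ℝ) * (Fintype.card α / k - 1) ≤ (lift c A).card := by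
    rw [h1, ← nsmul_eq_mul]
    exact Finset.card_nsmul_le_sum _ _ _ fun i _ => h.le_card_real i
  have h3 : (A.card : ℝ) ≤ k := by
    have := Finset.card_le_univ A
    rw [Fintype.card_fin] at this
    exact_mod_cast this
  have h4 : (1 / 2 - σ) * Fintype.card α ≤ A.card * (Fintype.card α / k) := by
    calc _ = (1 / 2 - σ) * k * (Fintype.card α / k) := by field_simp
      _ ≤ _ := by gcongr
  rw [div_le_iff₀ hq] at hα
  nlinarith

lemma IsRegularLabelling.nearSplit [DecidableEq α] (h : IsRegularLabelling G ε c) (hd : 0 ≤ d)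
    (hd1 : d ≤ 1) (hq : 0 < q) (hq1 : q ≤ 1) (hε1 : ε ≤ q / 8) (hk : 8 / q ≤ k)
    (hα : 1000 * k / q ≤ Fintype.card α) {σ τ : ℝ}
    (hs : NearSplit (reducedGraph G ε d c) σ τ) : NearSplit G (σ + q) (τ + d + q) := by
  obtain ⟨A, hA, hA', hor⟩ := hs
  rw [Fintype.card_fin] at hA hA' hor
  have key := h.interPairs_lift_le_add hd hd1 hq hq1 hε1 hk hα
  refine ⟨lift c A, h.le_card_lift hq hk hα hA, ?_, ?_⟩
  · rw [← lift_compl]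
    exact h.le_card_lift hq hk hα hA'
  · rw [← lift_compl]
    rcases hor with h1 | ⟨h1, h2⟩
    · left
      linarith [key A Aᶜ]
    · right
      exact ⟨by linarith [key A A], by linarith [key Aᶜ Aᶜ]⟩

lemma IsRegularLabelling.le_interPairs_reducedGraph (h : IsRegularLabelling G ε c) (hd : 0 ≤ d)
    (hd1 : d ≤ 1) (hq : 0 < q) (hq1 : q ≤ 1) (hε1 : ε ≤ q / 8) (hk : 8 / q ≤ k)
    (hα : 1000 * k / q ≤ Fintype.card α) {ρ : ℝ}
    (hρ : ρ ≤ (interPairs G univ univ : ℝ) / (Fintype.card α : ℝ) ^ 2) :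
    ρ - d - q ≤ (interPairs (reducedGraph G ε d c) univ univ : ℝ) / (k : ℝ) ^ 2 := by
  have key := h.interPairs_lift_le_add hd hd1 hq hq1 hε1 hk hα univ univ
  rw [lift_univ] at key
  linarith

end Clusters

section Embedding

/-- In a regular pair few vertices have small degree into a large set. -/
lemma card_low_degree_lt {W : Type*} {H : SimpleGraph W} {ε d : ℝ} {X Y Y' : Finset W}
    (hε : 0 < ε) (h : IsRegularPair H ε X Y) (hd : d ≤ _root_.dens H X Y) (hX : X.Nonempty)
    (hY' : Y' ⊆ Y) (hYY' : ε * Y.card ≤ Y'.card) :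
    ((X.filter fun x => ((Y'.filter (H.Adj x)).card : ℝ) < (d - ε) * Y'.card).card : ℝ) <
      ε * X.card := by
  by_contra! hB
  set B := X.filter fun x => ((Y'.filter (H.Adj x)).card : ℝ) < (d - ε) * Y'.card with hBdef
  have hB0 : (0 : ℝ) < B.card :=
    lt_of_lt_of_le (mul_pos hε (by exact_mod_cast hX.card_pos)) hB
  have hBne : B.Nonempty := Finset.card_pos.1 (by exact_mod_cast hB0)
  have hdens : d - ε ≤ _root_.dens H B Y' := by
    have := abs_le.1 (h B (Finset.filter_subset _ _) Y' hY' hB hYY')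
    linarith [this.1]
  have hlt : (interPairs H B Y' : ℝ) < B.card * ((d - ε) * Y'.card) := by
    rw [interPairs_eq_sum, ← nsmul_eq_mul]
    push_cast
    rw [← Finset.sum_const]
    exact Finset.sum_lt_sum_of_nonempty hBne fun x hx => (Finset.mem_filter.1 hx).2
  have hY0 : (0 : ℝ) < Y'.card := by
    rcases (Nat.cast_nonneg (α := ℝ) Y'.card).eq_or_lt with h0 | h0
    · rw [← h0, mul_zero, mul_zero] at hlt
      exact absurd hlt (not_lt.2 (Nat.cast_nonneg _))
    · exact h0
  unfold _root_.dens at hdens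
  rw [le_div_iff₀ (by positivity)] at hdens
  linarith

variable {V W : Type*} {H : SimpleGraph W} {Γ : SimpleGraph V} {U : V → Finset W} {γ β d : ℝ}

/-- Greedy embedding of a walk, starting in a prescribed set `X` and ending in a reserved
set `Z`. -/
lemma exists_path_of_walk (hdisj : ∀ a b, a ≠ b → Disjoint (U a) (U b)) (hd : 0 < d) (hγβ : γ ≤ β) (hβ : γ ≤ d * β)
    (hreg : ∀ a b, Γ.Adj a b → ∀ Y ⊆ U b, γ ≤ Y.card →
      (((U a).filter fun x => ((Y.filter (H.Adj x)).card : ℝ) < d * Y.card).card : ℝ) < γ)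
    {a b : V} (p : Γ.Walk a b) (hp : 0 < p.length) (F Z X : Finset W) (hXU : X ⊆ U a)
    (hXF : Disjoint X F) (hX : γ ≤ X.card) (hZU : Z ⊆ U b) (hZ : γ ≤ Z.card) (hZ0 : Z.Nonempty)
    (hU : ∀ v, β + p.support.count v ≤ (U v \ F).card) :
    ∃ x ∈ X, ∃ l : List W, ∃ z ∈ Z, List.IsChain H.Adj (x :: (l ++ [z])) ∧ (x :: l).Nodup ∧
      (∀ y ∈ x :: l, y ∉ F) ∧ (x :: l).length = p.length := by
  have hpick : ∀ {a c : V}, Γ.Adj a c → ∀ X ⊆ U a, γ ≤ X.card → ∀ Y ⊆ U c, γ ≤ Y.card →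
      ∃ x ∈ X, d * Y.card ≤ (Y.filter (H.Adj x)).card := by
    intro a c hac X hXU hX Y hY hYc
    by_contra! hcon
    have h1 := hreg a c hac Y hY hYc
    have h2 : X ⊆ (U a).filter fun x => ((Y.filter (H.Adj x)).card : ℝ) < d * Y.card :=
      fun x hx => Finset.mem_filter.2 ⟨hXU hx, hcon x hx⟩
    have h3 : (X.card : ℝ) ≤ _ := Nat.cast_le.2 (Finset.card_le_card h2)
    linarith
  induction p generalizing F X with
  | nil => simp at hp
  | @cons a c b h p ih =>
    rcases Nat.eq_zero_or_pos p.length with h0 | h0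
    · have hcb : c = b := SimpleGraph.Walk.eq_of_length_eq_zero h0
      subst hcb
      obtain ⟨x, hx, hdeg⟩ := hpick h X hXU hX Z hZU hZ
      have hpos : (0 : ℝ) < (Z.filter (H.Adj x)).card :=
        lt_of_lt_of_le (mul_pos hd (by exact_mod_cast hZ0.card_pos)) hdeg
      obtain ⟨z, hz⟩ := Finset.card_pos.1 (by exact_mod_cast hpos)
      rw [Finset.mem_filter] at hz
      refine ⟨x, hx, [], z, hz.1, ?_, ?_, ?_, ?_⟩
      · simpa using hz.2
      · simp
      · simpa using Finset.disjoint_left.1 hXF hx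
      · simp [h0]
    · have hY : β ≤ ((U c \ F).card : ℝ) := by
        have := hU c
        have h2 : (0 : ℝ) ≤ ((SimpleGraph.Walk.cons h p).support.count c : ℝ) := by positivity
        linarith
      obtain ⟨x, hx, hdeg⟩ := hpick h X hXU hX (U c \ F) Finset.sdiff_subset (hγβ.trans hY)
      have hX' : γ ≤ (((U c \ F).filter (H.Adj x)).card : ℝ) := by
        refine hβ.trans (le_trans ?_ hdeg)
        gcongr
      obtain ⟨x', hx', l, z, hz, hch, hnd, hF, hlen⟩ := ih h0 (insert x F)
        ((U c \ F).filter (H.Adj x)) ((Finset.filter_subset _ _).trans Finset.sdiff_subset) (by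
          rw [Finset.disjoint_left]
          intro y hy hy'
          rw [Finset.mem_filter, Finset.mem_sdiff] at hy
          rcases Finset.mem_insert.1 hy' with rfl | hy'
          · exact H.loopless.irrefl _ hy.2
          · exact hy.1.2 hy') hX' hZU (by
          intro v
          have h1 := hU v
          rw [SimpleGraph.Walk.support_cons, List.count_cons] at h1
          by_cases hva : a = v
          · subst hva
            simp only [beq_self_eq_true, if_true] at h1
            have h2 : (U a \ F).card ≤ (U a \ insert x F).card + 1 := by
              have : U a \ F ⊆ insert x (U a \ insert x F) := by
                intro y hy
                simp only [Finset.mem_insert, Finset.mem_sdiff] at hy ⊢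
                tauto
              exact (Finset.card_le_card this).trans (Finset.card_insert_le _ _)
            have h2' : ((U a \ F).card : ℝ) ≤ (U a \ insert x F).card + 1 := by exact_mod_cast h2
            push_cast at h1
            linarith
          · have hxv : x ∉ U v := Finset.disjoint_left.1 (hdisj a v hva) (hXU hx)
            have h2 : U v \ insert x F = U v \ F := by
              ext y
              simp only [Finset.mem_insert, Finset.mem_sdiff]
              constructor
              · tauto
              · rintro ⟨hy, hyF⟩
                refine ⟨hy, ?_⟩
                rintro (rfl | hy')
                · exact hxv hy
                · exact hyF hy'
            simp only [beq_iff_eq, hva, if_false] at h1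
            rw [h2]
            exact h1)
      rw [Finset.mem_filter] at hx'
      refine ⟨x, hx, x' :: l, z, hz, ?_, ?_, ?_, ?_⟩
      · rw [List.cons_append, List.isChain_cons_cons]
        exact ⟨hx'.2, hch⟩
      · rw [List.nodup_cons]
        exact ⟨fun hmem => hF x hmem (Finset.mem_insert_self _ _), hnd⟩
      · intro y hy
        rcases List.mem_cons.1 hy with rfl | hy
        · exact Finset.disjoint_left.1 hXF hx
        · exact fun hyF => hF y hy (Finset.mem_insert_of_mem hyF)
      · rw [List.length_cons, hlen, SimpleGraph.Walk.length_cons]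

/-- A closed walk visiting no label too often is realised by a cycle of the same length. -/
lemma exists_cycle_of_closed_walk (hdisj : ∀ a b, a ≠ b → Disjoint (U a) (U b)) (hd : 0 < d)
    (hγ : 0 < γ) (hγβ : γ ≤ β) (hβ : γ ≤ d * β) (hβ1 : 1 ≤ β)
    (hreg : ∀ a b, Γ.Adj a b → ∀ Y ⊆ U b, γ ≤ Y.card →
      (((U a).filter fun x => ((Y.filter (H.Adj x)).card : ℝ) < d * Y.card).card : ℝ) < γ)
    {r : V} (p : Γ.Walk r r) (hp : 3 ≤ p.length)
    (hU : ∀ v, 4 * β + p.support.count v ≤ (U v).card) :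
    ∃ x y : W, ∃ l : List W, (x :: (l ++ [y])).length = p.length ∧ (x :: (l ++ [y])).Nodup ∧
      List.IsChain H.Adj (x :: (l ++ [y])) ∧ H.Adj y x := by
  have hU4 : ∀ v, 4 * β ≤ ((U v).card : ℝ) := fun v => by
    have := hU v
    have h2 : (0 : ℝ) ≤ (p.support.count v : ℝ) := by positivity
    linarith
  cases p with
  | nil => simp at hp
  | @cons _ a _ h₁ p =>
  cases p with
  | nil => simp at hp
  | @cons _ b _ h₂ p =>
  have hlen : 0 < p.length := by
    simp only [SimpleGraph.Walk.length_cons] at hp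
    omega
  obtain ⟨Z₀, hZ₀U, hZ₀c⟩ := Finset.exists_subset_card_eq (s := U r) (n := ⌈β⌉₊) (by
    have := hU4 r
    have h2 := Nat.ceil_lt_add_one (zero_le_one.trans hβ1)
    have h3 : (⌈β⌉₊ : ℝ) ≤ (U r).card := by linarith
    exact_mod_cast h3)
  have hZ₀β : β ≤ (Z₀.card : ℝ) := by
    rw [hZ₀c]
    exact Nat.le_ceil β
  have hZ₀β' : (Z₀.card : ℝ) ≤ β + 1 := by
    rw [hZ₀c]
    exact (Nat.ceil_lt_add_one (zero_le_one.trans hβ1)).le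
  have hsd : ∀ (v : V) (F : Finset W), ((U v).card : ℝ) - F.card ≤ (U v \ F).card := by
    intro v F
    have h1 : (U v).card ≤ (U v \ F).card + F.card := by
      have := Finset.le_card_sdiff F (U v)
      omega
    have h2 : ((U v).card : ℝ) ≤ (U v \ F).card + F.card := by exact_mod_cast h1
    linarith
  have hY : β ≤ ((U b \ Z₀).card : ℝ) := by linarith [hsd b Z₀, hU4 b]
  obtain ⟨x, hx, hxZ, hxY⟩ : ∃ x ∈ U a \ Z₀, d * Z₀.card ≤ (Z₀.filter (H.Adj x)).card ∧
      d * (U b \ Z₀).card ≤ ((U b \ Z₀).filter (H.Adj x)).card := by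
    by_contra! hcon
    have h1 := hreg a r h₁.symm Z₀ hZ₀U (hγβ.trans hZ₀β)
    have h2 := hreg a b h₂ (U b \ Z₀) Finset.sdiff_subset (hγβ.trans hY)
    have h3 : U a \ Z₀ ⊆
        ((U a).filter fun x => ((Z₀.filter (H.Adj x)).card : ℝ) < d * Z₀.card) ∪
        ((U a).filter fun x => (((U b \ Z₀).filter (H.Adj x)).card : ℝ) <
          d * (U b \ Z₀).card) := by
      intro x hx
      have hxa := (Finset.mem_sdiff.1 hx).1
      rw [Finset.mem_union, Finset.mem_filter, Finset.mem_filter]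
      by_cases hxZ : d * Z₀.card ≤ (Z₀.filter (H.Adj x)).card
      · exact Or.inr ⟨hxa, hcon x hx hxZ⟩
      · exact Or.inl ⟨hxa, not_le.1 hxZ⟩
    have h4 : ((U a \ Z₀).card : ℝ) ≤ _ :=
      Nat.cast_le.2 ((Finset.card_le_card h3).trans (Finset.card_union_le _ _))
    push_cast at h4
    linarith [hsd a Z₀, hU4 a]
  have hZc : γ ≤ ((Z₀.filter (H.Adj x)).card : ℝ) := by
    refine hβ.trans (le_trans ?_ hxZ)
    gcongr
  have hXc : γ ≤ (((U b \ Z₀).filter (H.Adj x)).card : ℝ) := by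
    refine hβ.trans (le_trans ?_ hxY)
    gcongr
  obtain ⟨x', hx', l, z, hz, hch, hnd, hF, hl⟩ := exists_path_of_walk hdisj hd hγβ hβ hreg p hlen
    (insert x Z₀) (Z₀.filter (H.Adj x)) ((U b \ Z₀).filter (H.Adj x))
    ((Finset.filter_subset _ _).trans Finset.sdiff_subset) (by
      rw [Finset.disjoint_left]
      intro y hy hy'
      rw [Finset.mem_filter, Finset.mem_sdiff] at hy
      rcases Finset.mem_insert.1 hy' with rfl | hy'
      · exact H.loopless.irrefl _ hy.2
      · exact hy.1.2 hy') hXc ((Finset.filter_subset _ _).trans hZ₀U) hZc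
    (Finset.card_pos.1 (by exact_mod_cast hγ.trans_le hZc)) (by
      intro v
      have h1 := hU v
      have h2 : p.support.count v ≤
          (SimpleGraph.Walk.cons h₁ (SimpleGraph.Walk.cons h₂ p)).support.count v := by
        simp only [SimpleGraph.Walk.support_cons]
        exact List.count_le_count_cons.trans List.count_le_count_cons
      have h2' : (p.support.count v : ℝ) ≤ _ := Nat.cast_le.2 h2
      have h3 := hsd v (insert x Z₀)
      have h4 : ((insert x Z₀).card : ℝ) ≤ Z₀.card + 1 := by
        exact_mod_cast Finset.card_insert_le _ _
      linarith)
  rw [Finset.mem_filter] at hx' hz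
  have hxZ₀ := (Finset.mem_sdiff.1 hx).2
  refine ⟨x, z, x' :: l, ?_, ?_, ?_, hz.2.symm⟩
  · simp only [List.length_cons, List.length_append, List.length_nil,
      SimpleGraph.Walk.length_cons] at hl ⊢
    omega
  · rw [List.nodup_cons, List.mem_append, List.mem_singleton]
    refine ⟨?_, ?_⟩
    · rintro (hmem | rfl)
      · exact hF x hmem (Finset.mem_insert_self _ _)
      · exact hxZ₀ hz.1
    · rw [List.nodup_append]
      refine ⟨hnd, List.nodup_singleton _, ?_⟩
      intro y hy y' hy' heq
      rw [List.mem_singleton] at hy'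
      subst hy' heq
      exact hF _ hy (Finset.mem_insert_of_mem hz.1)
  · rw [List.cons_append, List.isChain_cons_cons]
    exact ⟨hx'.2, hch⟩

lemma exists_zmod_cycle_of_list {x y : W} {l : List W} (hnd : (x :: (l ++ [y])).Nodup)
    (hch : List.IsChain H.Adj (x :: (l ++ [y]))) (hyx : H.Adj y x) {t : ℕ}
    (ht : (x :: (l ++ [y])).length = t) :
    ∃ f : ZMod t → W, Function.Injective f ∧ ∀ i, H.Adj (f i) (f (i + 1)) := by
  obtain rfl : t = l.length + 1 + 1 := by rw [← ht]; simp
  have hlt : ∀ i : Fin (l.length + 1 + 1), i.val < (x :: (l ++ [y])).length :=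
    fun i => ht.symm ▸ i.isLt
  refine ⟨fun i : Fin (l.length + 1 + 1) => (x :: (l ++ [y]))[i.val]'(hlt i), ?_, ?_⟩
  · intro i j hij
    exact Fin.ext ((List.Nodup.getElem_inj_iff hnd).1 hij)
  · intro (i : Fin (l.length + 1 + 1))
    change H.Adj ((x :: (l ++ [y]))[i.val]'(hlt i)) ((x :: (l ++ [y]))[(i + 1).val]'(hlt (i + 1)))
    by_cases hi : i = Fin.last _
    · subst hi
      have h0 : ((Fin.last (l.length + 1)) + 1 : Fin (l.length + 1 + 1)) = 0 := by simp
      simp only [h0]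
      simpa using hyx
    · have h1 : (i + 1).val = i.val + 1 := by
        rw [Fin.val_add_one, if_neg hi]
      simp only [h1]
      exact List.isChain_iff_getElem.1 hch i.val (by rw [← h1]; exact hlt _)

end Embedding

section ClosedWalks

variable {V : Type*} {Γ : SimpleGraph V}

lemma exists_walk_back_and_forth {v w : V} (h : Γ.Adj v w) (n : ℕ) :
    ∃ p : Γ.Walk v v, p.length = 2 * n ∧ ∀ u, p.support.count u ≤
      1 + (if u = v then n else 0) + (if u = w then n else 0) := by
  have hne := h.ne
  induction n with
  | zero =>
    refine ⟨.nil, rfl, fun u => ?_⟩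
    simp only [SimpleGraph.Walk.support_nil, List.count_singleton]
    split_ifs <;> simp
  | succ n ih =>
    obtain ⟨p, hp, hc⟩ := ih
    refine ⟨.cons h (.cons h.symm p), ?_, fun u => ?_⟩
    · simp only [SimpleGraph.Walk.length_cons, hp]
      ring
    · have := hc u
      simp only [SimpleGraph.Walk.support_cons, List.count_cons, beq_iff_eq, eq_comm (b := u)]
      split_ifs at this ⊢ <;> omega

lemma count_support_append_le {a b c : V} (p : Γ.Walk a b) (q : Γ.Walk b c) (u : V) :
    (p.append q).support.count u ≤ p.support.count u + q.support.count u := by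
  rw [SimpleGraph.Walk.support_append, List.count_append]
  exact Nat.add_le_add_left (List.Sublist.count_le u (List.tail_sublist _)) _

lemma count_support_le_length {a b : V} (p : Γ.Walk a b) (u : V) :
    p.support.count u ≤ p.length + 1 := by
  rw [← SimpleGraph.Walk.length_support]
  exact List.count_le_length

/-- Starting from a closed walk at `r`, one can visit each vertex `v` of `F` and go `s v` times back
and forth along the edge from `v` to `g v`. -/
lemma exists_closed_walk_of_visits {r : V} {g : V → V} {F : Finset V} (s : V → ℕ) {D : V → ℕ}
    {K : ℕ} (hg : ∀ v, g (g v) = v) (hF : ∀ v ∈ F, Γ.Adj v (g v))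
    (hD : ∀ v ∈ F, D v < K ∧ ∃ p : Γ.Walk r v, p.length = D v) (p₀ : Γ.Walk r r) :
    ∃ p : Γ.Walk r r, p.length = p₀.length + ∑ v ∈ F, (2 * D v + 2 * s v) ∧
      ∀ u, p.support.count u ≤ p₀.length + 1 + F.card * (2 * K + 1) +
        (if u ∈ F then s u else 0) + (if g u ∈ F then s (g u) else 0) := by
  induction F using Finset.induction_on with
  | empty =>
    exact ⟨p₀, by simp, fun u => by simpa using count_support_le_length p₀ u⟩
  | insert v F hv ih =>
    obtain ⟨p, hp, hc⟩ := ih (fun v h => hF v (mem_insert_of_mem h))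
      (fun v h => hD v (mem_insert_of_mem h))
    obtain ⟨hK, q, hq⟩ := hD v (mem_insert_self _ _)
    obtain ⟨b, hb, hbc⟩ := exists_walk_back_and_forth (hF v (mem_insert_self _ _)) (s v)
    refine ⟨p.append (q.append (b.append q.reverse)), ?_, fun u => ?_⟩
    · simp only [SimpleGraph.Walk.length_append, SimpleGraph.Walk.length_reverse, hp, hb, hq,
        Finset.sum_insert hv]
      ring
    · have h1 := count_support_append_le p (q.append (b.append q.reverse)) u
      have h2 := count_support_append_le q (b.append q.reverse) u
      have h3 := count_support_append_le b q.reverse u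
      have h4 := count_support_le_length q u
      have h5 := count_support_le_length q.reverse u
      rw [SimpleGraph.Walk.length_reverse] at h5
      have h6 := hbc u
      have h7 := hc u
      rw [Finset.card_insert_of_notMem hv]
      have h8 : (if u ∈ F then s u else 0) + (if u = v then s v else 0) =
          if u ∈ insert v F then s u else 0 := by
        by_cases huv : u = v
        · subst huv; simp [hv]
        · simp [huv]
      have h9 : (if g u ∈ F then s (g u) else 0) + (if u = g v then s v else 0) =
          if g u ∈ insert v F then s (g u) else 0 := by
        by_cases huv : g u = v
        · have : u = g v := by rw [← huv, hg]
          simp [this, hg, hv]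
        · have : u ≠ g v := fun h => huv (by rw [h, hg])
          simp [huv, this]
      rw [← h8, ← h9]
      have h10 : (F.card + 1) * (2 * K + 1) = F.card * (2 * K + 1) + (2 * K + 1) := by ring
      omega

lemma exists_walk_length_lt_card [Fintype V] {r v : V} (h : Γ.Reachable r v) :
    Γ.dist r v < Fintype.card V ∧ ∃ p : Γ.Walk r v, p.length = Γ.dist r v := by
  refine ⟨?_, h.exists_walk_length_eq_dist⟩
  obtain ⟨p, hp, hl⟩ := h.exists_path_of_dist
  exact hl ▸ hp.length_lt

/-- A function on `F` with a prescribed sum that is as constant as possible. -/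
lemma exists_sum_eq_of_le_div {F : Finset V} (hF : F.Nonempty) (R : ℕ) :
    ∃ s : V → ℕ, ∑ v ∈ F, s v = R ∧ ∀ v, s v ≤ R / F.card + 1 := by
  obtain ⟨F', hF', hc⟩ := Finset.exists_subset_card_eq (Nat.mod_lt R hF.card_pos).le
  refine ⟨fun v => R / F.card + if v ∈ F' then 1 else 0, ?_, fun v => ?_⟩
  · rw [Finset.sum_add_distrib, Finset.sum_const, smul_eq_mul, ← Finset.card_filter,
      Finset.filter_mem_eq_inter, Finset.inter_eq_right.2 hF', hc]
    exact Nat.div_add_mod R F.card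
  · dsimp only
    split_ifs <;> simp

/-- If the component of `r` contains an odd cycle, then all long enough odd closed walks can be
spread evenly over a set `F` matched within the component. -/
lemma exists_closed_walk_of_odd [Fintype V] {r a b : V} {g : V → V} {F : Finset V}
    (hg : ∀ v, g (g v) = v) (hF : ∀ v ∈ F, Γ.Adj v (g v)) (hFr : ∀ v ∈ F, Γ.Reachable r v)
    (hF0 : F.Nonempty) (ha : Γ.Reachable r a) (hab : Γ.Adj a b)
    (hpar : Even (Γ.dist r a + Γ.dist r b)) {t : ℕ} (ht : Odd t)
    (htk : 2 * Fintype.card V ^ 2 + 2 * Fintype.card V ≤ t) (hV : 7 ≤ Fintype.card V) :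
    ∃ p : Γ.Walk r r, p.length = t ∧
      ∀ u, (p.support.count u : ℝ) ≤ (t : ℝ) / F.card + 3 * (Fintype.card V : ℝ) ^ 2 := by
  obtain ⟨hal, pa, hpa⟩ := exists_walk_length_lt_card ha
  obtain ⟨hbl, pb, hpb⟩ := exists_walk_length_lt_card (ha.trans hab.reachable)
  let p₀ : Γ.Walk r r := pa.append (.cons hab pb.reverse)
  have hp₀ : p₀.length = Γ.dist r a + Γ.dist r b + 1 := by
    simp only [p₀, SimpleGraph.Walk.length_append, SimpleGraph.Walk.length_cons,
      SimpleGraph.Walk.length_reverse, hpa, hpb]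
    ring
  have hdist : ∑ v ∈ F, 2 * Γ.dist r v ≤ 2 * Fintype.card V ^ 2 := by
    calc ∑ v ∈ F, 2 * Γ.dist r v ≤ F.card • (2 * Fintype.card V) :=
          Finset.sum_le_card_nsmul _ _ _ fun v hv =>
            Nat.mul_le_mul_left 2 (exists_walk_length_lt_card (hFr v hv)).1.le
      _ ≤ Fintype.card V * (2 * Fintype.card V) :=
          Nat.mul_le_mul_right _ (Finset.card_le_univ _)
      _ = 2 * Fintype.card V ^ 2 := by ring
  obtain ⟨R, hR⟩ : ∃ R, p₀.length + ∑ v ∈ F, 2 * Γ.dist r v + 2 * R = t := by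
    obtain ⟨i, hi⟩ := hpar
    obtain ⟨j, hj⟩ := ht
    rw [← Finset.mul_sum] at hdist ⊢
    exact ⟨j - i - ∑ v ∈ F, Γ.dist r v, by omega⟩
  obtain ⟨s, hs, hsle⟩ := exists_sum_eq_of_le_div hF0 R
  obtain ⟨p, hp, hc⟩ := exists_closed_walk_of_visits s hg hF
    (fun v hv => exists_walk_length_lt_card (hFr v hv)) p₀
  refine ⟨p, ?_, fun u => ?_⟩
  · rw [hp, Finset.sum_add_distrib, ← Finset.mul_sum (f := s), hs, ← hR]
    ring
  · have h1 := hc u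
    have h2 : (if u ∈ F then s u else 0) ≤ R / F.card + 1 := by
      split_ifs
      · exact hsle u
      · simp
    have h3 : (if g u ∈ F then s (g u) else 0) ≤ R / F.card + 1 := by
      split_ifs
      · exact hsle (g u)
      · simp
    have h4 : F.card * (2 * Fintype.card V + 1) ≤
        Fintype.card V * (2 * Fintype.card V + 1) :=
      Nat.mul_le_mul_right _ (Finset.card_le_univ _)
    have h5 : p.support.count u ≤ 2 * Fintype.card V + 2 +
        Fintype.card V * (2 * Fintype.card V + 1) + 2 * (R / F.card) := by omega
    have h6 : ((R / F.card : ℕ) : ℝ) ≤ (R : ℝ) / F.card := Nat.cast_div_le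
    have h7 : (p.support.count u : ℝ) ≤ 2 * Fintype.card V + 2 +
        Fintype.card V * (2 * Fintype.card V + 1) + 2 * ((R / F.card : ℕ) : ℝ) := by
      exact_mod_cast h5
    have h8 : 2 * ((R : ℝ) / F.card) ≤ t / F.card := by
      rw [← mul_div_assoc]
      gcongr
      exact_mod_cast (by omega : 2 * R ≤ t)
    have h9 : (7 : ℝ) ≤ Fintype.card V := by exact_mod_cast hV
    nlinarith

end ClosedWalks

section MaximalMatching

variable {V : Type*} {Γ : SimpleGraph V} {g g' : V → V}

/-- A matching, encoded as the involution exchanging matched vertices and fixing the others. -/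
def IsMatchingInvolution (Γ : SimpleGraph V) (g : V → V) : Prop :=
  ∀ v, g (g v) = v ∧ (g v = v ∨ Γ.Adj v (g v))

/-- A matching covering the largest possible number of vertices. -/
def IsMaximumMatchingInvolution [Fintype V] (Γ : SimpleGraph V) (g : V → V) : Prop :=
  IsMatchingInvolution Γ g ∧ ∀ g', IsMatchingInvolution Γ g' →
    (univ.filter fun v => g' v ≠ v).card ≤ (univ.filter fun v => g v ≠ v).card

lemma exists_isMaximumMatchingInvolution [Fintype V] (Γ : SimpleGraph V) :
    ∃ g, IsMaximumMatchingInvolution Γ g := by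
  obtain ⟨g, hg, hmax⟩ := Finset.exists_max_image
    (univ.filter fun g : V → V => IsMatchingInvolution Γ g)
    (fun g => (univ.filter fun v => g v ≠ v).card)
    ⟨id, mem_filter.2 ⟨mem_univ _, fun v => ⟨rfl, Or.inl rfl⟩⟩⟩
  exact ⟨g, (mem_filter.1 hg).2, fun g' hg' => hmax g' (by simpa using hg')⟩

variable [Fintype V]

lemma IsMaximumMatchingInvolution.apply_eq_self (h : IsMaximumMatchingInvolution Γ g)
    (hg' : IsMatchingInvolution Γ g') (hs : ∀ z, g z ≠ z → g' z ≠ z) {a : V} (ha : g a = a) :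
    g' a = a := by
  by_contra hne
  have hlt : (univ.filter fun v => g v ≠ v) ⊂ univ.filter fun v => g' v ≠ v := by
    refine Finset.ssubset_iff_of_subset (fun z hz => ?_) |>.2 ⟨a, by simp [hne], by simp [ha]⟩
    simp only [mem_filter, mem_univ, true_and] at hz ⊢
    exact hs z hz
  exact absurd (h.2 g' hg') (not_le.2 (Finset.card_lt_card hlt))

lemma IsMaximumMatchingInvolution.not_adj (h : IsMaximumMatchingInvolution Γ g) {a b : V}
    (ha : g a = a) (hb : g b = b) : ¬ Γ.Adj a b := by
  intro hab
  have hne := hab.ne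
  have h1 : IsMatchingInvolution Γ
      (fun z => if z = a then b else if z = b then a else g z) := by
    intro z
    have hz := h.1 z
    have hab' := hab.symm
    grind
  have := h.apply_eq_self h1 (by grind) ha
  grind

lemma IsMaximumMatchingInvolution.not_adj_partner (h : IsMaximumMatchingInvolution Γ g)
    {a b v : V} (ha : g a = a) (hb : g b = b) (hab : a ≠ b) (hav : Γ.Adj a v) :
    ¬ Γ.Adj (g v) b := by
  intro hvb
  have hv : g v ≠ v := fun hv => h.not_adj ha hv hav
  have hgv := (h.1 v).1
  have h1 : IsMatchingInvolution Γ (fun z => if z = a then v else if z = v then a else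
      if z = g v then b else if z = b then g v else g z) := by
    intro z
    have hz := h.1 z
    have hav' := hav.symm
    have hvb' := hvb.symm
    grind
  have := h.apply_eq_self h1 (by grind) ha
  grind

lemma IsMaximumMatchingInvolution.not_adj_partners (h : IsMaximumMatchingInvolution Γ g)
    {a b v w : V} (ha : g a = a) (hb : g b = b) (hab : a ≠ b) (hav : Γ.Adj a v) (hbw : Γ.Adj b w)
    (hvw : v ≠ w) (hvw' : g v ≠ w) : ¬ Γ.Adj (g v) (g w) := by
  intro hadj
  have hv : g v ≠ v := fun hv => h.not_adj ha hv hav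
  have hw : g w ≠ w := fun hw => h.not_adj hb hw hbw
  have hgv := (h.1 v).1
  have hgw := (h.1 w).1
  have h1 : IsMatchingInvolution Γ (fun z => if z = a then v else if z = v then a else
      if z = b then w else if z = w then b else
      if z = g v then g w else if z = g w then g v else g z) := by
    intro z
    have hz := h.1 z
    have hav' := hav.symm
    have hbw' := hbw.symm
    have hadj' := hadj.symm
    by_cases hza : z = a
    · grind
    by_cases hzv : z = v
    · grind
    by_cases hzb : z = b
    · grind
    by_cases hzw : z = w
    · grind
    by_cases hzv' : z = g v
    · grind
    by_cases hzw' : z = g w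
    · grind
    have h2 : g z ≠ a ∧ g z ≠ v ∧ g z ≠ b ∧ g z ≠ w ∧ g z ≠ g v ∧ g z ≠ g w := by grind
    simpa only [if_neg hza, if_neg hzv, if_neg hzb, if_neg hzw, if_neg hzv', if_neg hzw',
      if_neg h2.1, if_neg h2.2.1, if_neg h2.2.2.1, if_neg h2.2.2.2.1, if_neg h2.2.2.2.2.1,
      if_neg h2.2.2.2.2.2] using hz
  have := h.apply_eq_self h1 (by grind) ha
  grind

end MaximalMatching

section Structure

variable {V : Type*} [Fintype V] {Γ : SimpleGraph V}

/-- The vertices of the connected component of `r`. -/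
def component (Γ : SimpleGraph V) (r : V) : Finset V :=
  univ.filter fun v => Γ.Reachable r v

lemma mem_component {r v : V} : v ∈ component Γ r ↔ Γ.Reachable r v := by
  simp [component]

lemma mem_component_of_adj {r v w : V} (hv : v ∈ component Γ r) (h : Γ.Adj v w) :
    w ∈ component Γ r :=
  mem_component.2 ((mem_component.1 hv).trans h.reachable)

lemma interPairs_component_compl (r : V) (X Y : Finset V) (hX : X ⊆ component Γ r)
    (hY : Y ⊆ (component Γ r)ᶜ) : interPairs Γ X Y = 0 := by
  rw [interPairs, Finset.card_eq_zero, Finset.filter_eq_empty_iff]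
  rintro ⟨a, b⟩ hab hadj
  rw [Finset.mem_product] at hab
  exact Finset.mem_compl.1 (hY hab.2) (mem_component_of_adj (hX hab.1) hadj)

/-- Some connected component has at least the average degree of the graph. -/
lemma exists_component_average_le [Nonempty V] {D : ℝ}
    (hD : D * Fintype.card V ≤ interPairs Γ univ univ) :
    ∃ r, D * (component Γ r).card ≤ interPairs Γ (component Γ r) (component Γ r) := by
  have hfib : ∀ r, (univ.filter fun v => Γ.connectedComponentMk v = Γ.connectedComponentMk r) =
      component Γ r := by
    intro r
    ext v
    rw [mem_component, mem_filter, SimpleGraph.ConnectedComponent.eq]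
    exact ⟨fun h => h.2.symm, fun h => ⟨mem_univ _, h.symm⟩⟩
  have hsum : ∀ f : V → ℝ, ∑ κ, ∑ v with Γ.connectedComponentMk v = κ, f v = ∑ v, f v := by
    intro f
    convert Finset.sum_fiberwise univ Γ.connectedComponentMk f
  have hne : (univ : Finset Γ.ConnectedComponent).Nonempty :=
    ⟨Γ.connectedComponentMk (Classical.arbitrary V), mem_univ _⟩
  obtain ⟨κ, -, hκ⟩ := Finset.exists_le_of_sum_le hne
    (f := fun κ => ∑ v with Γ.connectedComponentMk v = κ, D)
    (g := fun κ => ∑ v with Γ.connectedComponentMk v = κ,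
      ((univ.filter (Γ.Adj v)).card : ℝ)) (by
      rw [hsum, hsum, Finset.sum_const, nsmul_eq_mul, mul_comm,
        Finset.card_univ]
      rw [interPairs_eq_sum] at hD
      exact_mod_cast hD)
  induction κ using SimpleGraph.ConnectedComponent.ind with
  | _ r =>
    refine ⟨r, ?_⟩
    rw [hfib, Finset.sum_const, nsmul_eq_mul, mul_comm] at hκ
    refine hκ.trans_eq ?_
    have h1 : interPairs Γ (component Γ r) univ =
        interPairs Γ (component Γ r) (component Γ r) := by
      rw [← Finset.union_compl (component Γ r), interPairs_union_right Γ _ disjoint_compl_right,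
        interPairs_component_compl r _ _ subset_rfl subset_rfl, add_zero]
    rw [← h1, interPairs_eq_sum]
    push_cast
    rfl

/-- A Gallai--Edmonds type bound on the number of edges inside a set closed under a maximum
matching, in terms of the numbers of matched and unmatched vertices. -/
lemma IsMaximumMatchingInvolution.interPairs_le {g : V → V} (h : IsMaximumMatchingInvolution Γ g)
    {C : Finset V} (hC : ∀ v ∈ C, g v ∈ C) :
    ∃ s : ℕ, 2 * s ≤ (C.filter fun v => g v ≠ v).card ∧
      interPairs Γ C C + s ^ 2 ≤ (C.filter fun v => g v ≠ v).card ^ 2 +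
        2 * (s * (C.filter fun v => g v = v).card + (C.filter fun v => g v ≠ v).card) := by
  set S := C.filter fun v => g v ≠ v with hS
  set I := C.filter fun v => g v = v with hI
  have hinv : Function.Involutive g := fun v => (h.1 v).1
  have hIg : ∀ a ∈ I, g a = a := fun a ha => (mem_filter.1 ha).2
  let T' := S.filter fun v => 1 < (I.filter (Γ.Adj v)).card
  let T := T'.image g
  have hnbr : ∀ v ∈ T', ∀ b, ∃ a ∈ I, a ≠ b ∧ Γ.Adj v a := by
    intro v hv b
    obtain ⟨a, ha, hab⟩ := Finset.exists_mem_ne (mem_filter.1 hv).2 b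
    exact ⟨a, (mem_filter.1 ha).1, hab, (mem_filter.1 ha).2⟩
  have hT'S : T' ⊆ S := Finset.filter_subset _ _
  have hTS : T ⊆ S := by
    intro u hu
    obtain ⟨v, hv, rfl⟩ := mem_image.1 hu
    have := mem_filter.1 (hT'S hv)
    exact mem_filter.2 ⟨hC v this.1, by rw [hinv v]; exact this.2.symm⟩
  have hTT' : ∀ v ∈ T', g v ∉ T' := by
    intro v hv hv'
    obtain ⟨b, hb, -, hvb⟩ := hnbr _ hv' v
    obtain ⟨a, ha, hab, hva⟩ := hnbr v hv b
    exact h.not_adj_partner (hIg a ha) (hIg b hb) hab hva.symm hvb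
  have hdisj : Disjoint T T' := by
    rw [Finset.disjoint_left]
    intro u hu
    obtain ⟨v, hv, rfl⟩ := mem_image.1 hu
    exact hTT' v hv
  have hcard : T.card = T'.card := Finset.card_image_of_injective _ hinv.injective
  have hTind : ∀ u ∈ T, ∀ u' ∈ T, ¬ Γ.Adj u u' := by
    intro u hu u' hu' hadj
    obtain ⟨v, hv, rfl⟩ := mem_image.1 hu
    obtain ⟨v', hv', rfl⟩ := mem_image.1 hu'
    obtain ⟨b, hb, -, hvb⟩ := hnbr _ hv' v
    obtain ⟨a, ha, hab, hva⟩ := hnbr v hv b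
    refine h.not_adj_partners (hIg a ha) (hIg b hb) hab hva.symm hvb.symm ?_ ?_ hadj
    · rintro rfl
      exact hadj.ne rfl
    · rintro rfl
      exact hTT' _ hv hv'
  have hSI : Disjoint S I := by
    rw [Finset.disjoint_left]
    intro v hv hv'
    exact (mem_filter.1 hv).2 (hIg v hv')
  have hCSI : C = S ∪ I := by
    rw [hS, hI, Finset.union_comm, Finset.filter_union_filter_not_eq]
  have hII : interPairs Γ I I = 0 := by
    rw [interPairs, Finset.card_eq_zero, Finset.filter_eq_empty_iff]
    rintro ⟨a, b⟩ hab
    rw [Finset.mem_product] at hab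
    exact h.not_adj (hIg _ hab.1) (hIg _ hab.2)
  have hSIle : interPairs Γ S I ≤ T'.card * I.card + S.card := by
    rw [interPairs_eq_sum]
    calc ∑ v ∈ S, (I.filter (Γ.Adj v)).card
        ≤ ∑ v ∈ S, ((if v ∈ T' then I.card else 0) + 1) := by
          refine Finset.sum_le_sum fun v hv => ?_
          split_ifs with hvT
          · exact (Finset.card_filter_le _ _).trans (Nat.le_succ _)
          · by_contra hlt
            exact hvT (mem_filter.2 ⟨hv, by omega⟩)
      _ = T'.card * I.card + S.card := by
          rw [Finset.sum_add_distrib, ← Finset.sum_filter, Finset.sum_const, smul_eq_mul,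
            Finset.filter_mem_eq_inter, Finset.inter_eq_right.2 hT'S, Finset.sum_const,
            smul_eq_mul, mul_one]
  have hSSle : interPairs Γ S S + T.card ^ 2 ≤ S.card ^ 2 := by
    rw [sq, sq, ← Finset.card_product, ← Finset.card_product, interPairs,
      ← Finset.card_union_of_disjoint]
    · exact Finset.card_le_card (Finset.union_subset (Finset.filter_subset _ _)
        (Finset.product_subset_product hTS hTS))
    · rw [Finset.disjoint_left]
      rintro ⟨a, b⟩ hab hab'
      rw [Finset.mem_product] at hab'
      exact hTind a hab'.1 b hab'.2 (mem_filter.1 hab).2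
  refine ⟨T.card, ?_, ?_⟩
  · have := Finset.card_le_card (Finset.union_subset hTS hT'S)
    rw [Finset.card_union_of_disjoint hdisj] at this
    omega
  · have hCC : interPairs Γ C C = interPairs Γ S S + 2 * interPairs Γ S I + interPairs Γ I I := by
      conv_lhs => rw [hCSI]
      rw [interPairs_union_left Γ hSI, interPairs_union_right Γ _ hSI,
        interPairs_union_right Γ _ hSI, interPairs_comm Γ I S]
      ring
    rw [hCC, hII]
    rw [hcard] at hSSle ⊢
    omega

end Structure

section Dichotomy

lemma interPairs_eq_zero {V : Type*} {Γ : SimpleGraph V} {X Y : Finset V} (h : ∀ a ∈ X, ∀ b ∈ Y, ¬ Γ.Adj a b) :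
    interPairs Γ X Y = 0 := by
  rw [interPairs, Finset.card_eq_zero, Finset.filter_eq_empty_iff]
  rintro ⟨a, b⟩ hab
  rw [Finset.mem_product] at hab
  exact h a hab.1 b hab.2

variable {V : Type*} [Fintype V] {Γ : SimpleGraph V} {q : ℝ} {r : V}

lemma component_nonempty (r : V) : (component Γ r).Nonempty :=
  ⟨r, mem_component.2 (SimpleGraph.Reachable.refl r)⟩

lemma sq_sqrt_le_div_of_le (hq : 0 < q) (hq1 : q ≤ 1 / 10 ^ 10) :
    0 < √q ∧ √q ≤ 1 / 10 ^ 5 ∧ √q ^ 2 = q := by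
  refine ⟨Real.sqrt_pos.2 hq, ?_, Real.sq_sqrt hq.le⟩
  rw [Real.sqrt_le_left (by positivity)]
  refine hq1.trans (le_of_eq (by norm_num))

/-- A bipartite component of nearly half the maximum average degree is nearly a balanced complete
bipartite spanning subgraph. -/
lemma nearSplit_of_bipartite (hq : 0 < q) (hq1 : q ≤ 1 / 10 ^ 10)
    (hD : (1 / 2 - 15 * q) * Fintype.card V * (component Γ r).card ≤
      interPairs Γ (component Γ r) (component Γ r))
    (hbip : ∀ a ∈ component Γ r, ∀ b, Γ.Adj a b → ¬ Even (Γ.dist r a + Γ.dist r b)) :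
    NearSplit Γ (3 * √q) (30 * q) := by
  obtain ⟨hh0, hh1, hh2⟩ := sq_sqrt_le_div_of_le hq hq1
  set h := √q
  set C := component Γ r with hC
  set X := C.filter fun v => Even (Γ.dist r v) with hX
  set Y := C.filter fun v => ¬ Even (Γ.dist r v) with hY
  have hXY : Disjoint X Y := Finset.disjoint_filter_filter_not _ _ _
  have hCXY : C = X ∪ Y := (Finset.filter_union_filter_not_eq _ _).symm
  have hXX : interPairs Γ X X = 0 := interPairs_eq_zero fun a ha b hb hab =>
    hbip a (mem_filter.1 ha).1 b hab ((mem_filter.1 ha).2.add (mem_filter.1 hb).2)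
  have hYY : interPairs Γ Y Y = 0 := interPairs_eq_zero fun a ha b hb hab =>
    hbip a (mem_filter.1 ha).1 b hab
      ((Nat.not_even_iff_odd.1 (mem_filter.1 ha).2).add_odd
        (Nat.not_even_iff_odd.1 (mem_filter.1 hb).2))
  have hCC : interPairs Γ C C ≤ 2 * (X.card * Y.card) := by
    conv_lhs => rw [hCXY]
    rw [interPairs_union_left Γ hXY, interPairs_union_right Γ _ hXY,
      interPairs_union_right Γ _ hXY, interPairs_comm Γ Y X, hXX, hYY]
    have := interPairs_le_mul Γ X Y
    omega
  have hcard : C.card = X.card + Y.card := by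
    conv_lhs => rw [hCXY]
    exact Finset.card_union_of_disjoint hXY
  have hck : (C.card : ℝ) ≤ Fintype.card V := by exact_mod_cast Finset.card_le_univ C
  have hc0 : (0 : ℝ) < C.card := by exact_mod_cast (component_nonempty r).card_pos
  have hcardR : (C.card : ℝ) = X.card + Y.card := by exact_mod_cast hcard
  have hCCR : (interPairs Γ C C : ℝ) ≤ 2 * (X.card * Y.card) := by exact_mod_cast hCC
  have hYX : Y ⊆ Xᶜ := fun v hv => Finset.mem_compl.2 (Finset.disjoint_right.1 hXY hv)
  have hXc : (Y.card : ℝ) ≤ Xᶜ.card := by exact_mod_cast Finset.card_le_card hYX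
  have hXcXc : interPairs Γ Xᶜ Xᶜ ≤ Cᶜ.card * Cᶜ.card := by
    have hYC : Disjoint Y Cᶜ := Finset.disjoint_left.2 fun v hv hv' =>
      Finset.mem_compl.1 hv' (mem_filter.1 hv).1
    have hXcu : Xᶜ = Y ∪ Cᶜ := by
      ext v
      have : v ∈ X → v ∉ Y := fun h => Finset.disjoint_left.1 hXY h
      simp only [hCXY, mem_compl, mem_union]
      tauto
    have h0 : interPairs Γ Y Cᶜ = 0 :=
      interPairs_component_compl r _ _ (Finset.filter_subset _ _) subset_rfl
    rw [hXcu, interPairs_union_left Γ hYC, interPairs_union_right Γ _ hYC,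
      interPairs_union_right Γ _ hYC, hYY, interPairs_comm Γ Cᶜ Y, h0]
    simpa using interPairs_le_mul Γ Cᶜ Cᶜ
  have hCc : (Cᶜ.card : ℝ) = Fintype.card V - C.card := by
    rw [Finset.card_compl, Nat.cast_sub (Finset.card_le_univ _)]
  have hXcR : (interPairs Γ Xᶜ Xᶜ : ℝ) ≤ Cᶜ.card * Cᶜ.card := by exact_mod_cast hXcXc
  rw [hCc] at hXcR
  have hk0 : (0 : ℝ) < Fintype.card V := hc0.trans_le hck
  set k := ((Fintype.card V : ℕ) : ℝ)
  set x := ((X.card : ℕ) : ℝ)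
  set y := ((Y.card : ℕ) : ℝ)
  set c := ((C.card : ℕ) : ℝ)
  have hDc : (1 / 2 - 15 * q) * k * c ≤ 2 * (x * y) := hD.trans hCCR
  have hc2 : (1 - 30 * q) * k ≤ c := by
    refine le_of_mul_le_mul_right ?_ hc0
    rw [hcardR] at hDc ⊢
    nlinarith [sq_nonneg (x - y)]
  have hxy : (x - y) ^ 2 ≤ (11 / 2 * h * k) ^ 2 := by
    have h1 : (x - y) ^ 2 ≤ c * (c - (1 - 30 * q) * k) := by
      rw [hcardR] at hDc ⊢
      nlinarith
    have h2 : c * (c - (1 - 30 * q) * k) ≤ k * (30 * q * k) :=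
      mul_le_mul hck (by linarith) (by linarith) hk0.le
    have h3 : 0 ≤ q * k ^ 2 := by positivity
    calc (x - y) ^ 2 ≤ k * (30 * q * k) := h1.trans h2
      _ ≤ 121 / 4 * q * k ^ 2 := by linarith
      _ = (11 / 2 * h * k) ^ 2 := by rw [← hh2]; ring
  obtain ⟨hl, hr⟩ := abs_le_of_sq_le_sq' hxy (by positivity)
  have hhk : 0 < h * k := by positivity
  have hqk : q * k ≤ 1 / 100 * (h * k) := by
    have : h * (h * k) ≤ 1 / 100 * (h * k) :=
      mul_le_mul_of_nonneg_right (by linarith) hhk.le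
    calc q * k = h * (h * k) := by rw [← hh2]; ring
      _ ≤ _ := this
  refine ⟨X, ?_, ?_, Or.inr ⟨?_, ?_⟩⟩
  · change (1 / 2 - 3 * h) * k ≤ x
    linarith
  · refine le_trans ?_ hXc
    change (1 / 2 - 3 * h) * k ≤ y
    linarith
  · rw [hXX]
    simp only [Nat.cast_zero, zero_div]
    positivity
  · rw [div_le_iff₀ (by positivity)]
    refine hXcR.trans ?_
    have h1 : (k - c) * (k - c) ≤ (30 * q * k) * k :=
      mul_le_mul (by linarith) (by linarith) (by linarith) (by positivity)
    linarith

/-- A component of nearly half the maximum average degree without a large matching has nearly half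
of the vertices. -/
lemma nearSplit_of_card_matched_lt {g : V → V} (hg : IsMaximumMatchingInvolution Γ g)
    (hq : 0 < q) (hq1 : q ≤ 1 / 10 ^ 10) (hk : 100 / q ≤ Fintype.card V)
    (hD : (1 / 2 - 15 * q) * Fintype.card V * (component Γ r).card ≤
      interPairs Γ (component Γ r) (component Γ r))
    (hw : (((component Γ r).filter fun v => g v ≠ v).card : ℝ) <
      (1 / 2 + 21 * q) * Fintype.card V) :
    NearSplit Γ (3 * √q) (30 * q) := by
  obtain ⟨hh0, hh1, hh2⟩ := sq_sqrt_le_div_of_le hq hq1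
  set h := √q
  set C := component Γ r with hC
  obtain ⟨s, hs, hCC⟩ := hg.interPairs_le (C := C) (by
    intro v hv
    rcases (hg.1 v).2 with h' | h'
    · rwa [h']
    · exact mem_component_of_adj hv h')
  have hcard : (C.filter fun v => g v ≠ v).card + (C.filter fun v => g v = v).card = C.card := by
    rw [add_comm]
    exact Finset.card_filter_add_card_filter_not _
  have hck : (C.card : ℝ) ≤ Fintype.card V := by exact_mod_cast Finset.card_le_univ C
  have hc0 : (0 : ℝ) < C.card := by exact_mod_cast (component_nonempty r).card_pos
  have hCc : (Cᶜ.card : ℝ) = Fintype.card V - C.card := by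
    rw [Finset.card_compl, Nat.cast_sub (Finset.card_le_univ _)]
  have hk0 : (0 : ℝ) < Fintype.card V := hc0.trans_le hck
  have hcross : interPairs Γ C Cᶜ = 0 := interPairs_component_compl r _ _ subset_rfl subset_rfl
  have hle : interPairs Γ C C ≤ C.card * C.card := interPairs_le_mul Γ C C
  have hleR : (interPairs Γ C C : ℝ) ≤ C.card * C.card := by exact_mod_cast hle
  have hcardR : ((C.filter fun v => g v ≠ v).card : ℝ) + ((C.filter fun v => g v = v).card : ℝ) =
    C.card := by exact_mod_cast hcard
  have hsR : 2 * (s : ℝ) ≤ (C.filter fun v => g v ≠ v).card := by exact_mod_cast hs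
  have hCCR : (interPairs Γ C C : ℝ) + (s : ℝ) ^ 2 ≤
      ((C.filter fun v => g v ≠ v).card : ℝ) ^ 2 + 2 * (s * ((C.filter fun v => g v = v).card : ℝ) +
        ((C.filter fun v => g v ≠ v).card : ℝ)) := by exact_mod_cast hCC
  have hx0 : (0 : ℝ) ≤ (C.filter fun v => g v = v).card := Nat.cast_nonneg _
  have hw0 : (0 : ℝ) ≤ (C.filter fun v => g v ≠ v).card := Nat.cast_nonneg _
  have hs0 : (0 : ℝ) ≤ s := Nat.cast_nonneg _
  set k := ((Fintype.card V : ℕ) : ℝ)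
  set c := ((C.card : ℕ) : ℝ)
  set w := (((C.filter fun v => g v ≠ v).card : ℕ) : ℝ)
  set x := (((C.filter fun v => g v = v).card : ℕ) : ℝ)
  have hclow : (1 / 2 - 15 * q) * k ≤ c :=
    le_of_mul_le_mul_right (hD.trans hleR) hc0
  have hwk : 2 * w ≤ 1 / 50 * q * k * k := by
    have : 100 ≤ k * q := (div_le_iff₀ hq).1 hk
    have h1 : w ≤ k := by linarith
    have h2 : 100 * k ≤ k * q * k := mul_le_mul_of_nonneg_right this hk0.le
    linarith
  have hDc : (1 / 2 - 15 * q) * k * (w + x) + s ^ 2 ≤ w ^ 2 + 2 * (s * x + w) := by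
    rw [hcardR]
    linarith
  have hqk : 0 < q * k := by positivity
  have hwD : w * (w - (1 / 2 - 15 * q) * k) ≤ 19 * q * k * k := by
    have h1 : w * (w - (1 / 2 - 15 * q) * k) ≤ w * (36 * (q * k)) :=
      mul_le_mul_of_nonneg_left (by linarith) hw0
    have h2 : w * (36 * (q * k)) ≤ (51 / 100 * k) * (36 * (q * k)) :=
      mul_le_mul_of_nonneg_right (by linarith [mul_le_mul_of_nonneg_right hq1 hk0.le])
        (by positivity)
    have h3 : 0 ≤ q * k * k := by positivity
    linarith
  have hxs : x * ((1 / 2 - 15 * q) * k - 2 * s) + s ^ 2 ≤ 20 * q * k * k := by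
    have h3 : 0 ≤ q * k * k := by positivity
    linarith
  have hs2 : s ^ 2 ≤ (8 * h * k) ^ 2 := by
    have h1 : x * (-(36 * (q * k))) ≤ x * ((1 / 2 - 15 * q) * k - 2 * s) :=
      mul_le_mul_of_nonneg_left (by linarith) hx0
    have h2 : x * (36 * (q * k)) ≤ k * (36 * (q * k)) :=
      mul_le_mul_of_nonneg_right (by linarith) (by positivity)
    have h3 : 0 ≤ q * k * k := by positivity
    calc s ^ 2 ≤ 64 * q * k * k := by linarith
      _ = (8 * h * k) ^ 2 := by rw [← hh2]; ring
  have hs8 : s ≤ 8 * h * k := (abs_le_of_sq_le_sq' hs2 (by positivity)).2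
  have hx : x ≤ 60 * q * k := by
    have h0 : h * k ≤ 1 / 1000 * k := mul_le_mul_of_nonneg_right (by linarith) hk0.le
    have h0' : q * k ≤ 1 / 1000 * k := mul_le_mul_of_nonneg_right (by linarith) hk0.le
    have h1 : 4 / 10 * k ≤ (1 / 2 - 15 * q) * k - 2 * s := by linarith
    have h2 : x * (4 / 10 * k) ≤ x * ((1 / 2 - 15 * q) * k - 2 * s) :=
      mul_le_mul_of_nonneg_left h1 hx0
    have h3 : 0 ≤ q * k * k := by positivity
    have h4 : x * k ≤ 60 * q * k * k := by linarith [sq_nonneg (s : ℝ)]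
    exact le_of_mul_le_mul_right h4 hk0
  have hhk : 0 < h * k := by positivity
  have hqhk : q * k ≤ 1 / 100 * (h * k) := by
    have : h * (h * k) ≤ 1 / 100 * (h * k) :=
      mul_le_mul_of_nonneg_right (by linarith) hhk.le
    calc q * k = h * (h * k) := by rw [← hh2]; ring
      _ ≤ _ := this
  refine ⟨C, ?_, ?_, Or.inl ?_⟩
  · change (1 / 2 - 3 * h) * k ≤ c
    linarith
  · rw [hCc]
    change (1 / 2 - 3 * h) * k ≤ k - c
    linarith
  · rw [hcross]
    simp only [Nat.cast_zero, zero_div]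
    positivity

/-- A graph of density nearly `1 / 2` either nearly splits in one of the two extremal ways, or it has
evenly spread closed walks of all large odd lengths. -/
theorem nearSplit_or_exists_closed_walk (hq : 0 < q) (hq1 : q ≤ 1 / 10 ^ 10)
    (hk : 100 / q ≤ Fintype.card V)
    (hd : 1 / 2 - 15 * q ≤ (interPairs Γ univ univ : ℝ) / (Fintype.card V : ℝ) ^ 2) :
    NearSplit Γ (3 * √q) (30 * q) ∨ ∀ t : ℕ, Odd t →
      2 * Fintype.card V ^ 2 + 2 * Fintype.card V ≤ t → ∃ r, ∃ p : Γ.Walk r r, p.length = t ∧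
        ∀ u, (p.support.count u : ℝ) ≤
          (t : ℝ) / ((1 / 2 + 21 * q) * Fintype.card V) + 3 * (Fintype.card V : ℝ) ^ 2 := by
  have hk0 : (0 : ℝ) < Fintype.card V := lt_of_lt_of_le (by positivity) hk
  have : Nonempty V := Fintype.card_pos_iff.1 (by exact_mod_cast hk0)
  rw [le_div_iff₀ (by positivity)] at hd
  obtain ⟨r, hr⟩ := exists_component_average_le (Γ := Γ)
    (D := (1 / 2 - 15 * q) * Fintype.card V) (by linarith)
  obtain ⟨g, hg⟩ := exists_isMaximumMatchingInvolution Γ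
  by_cases hbip : ∀ a ∈ component Γ r, ∀ b, Γ.Adj a b → ¬ Even (Γ.dist r a + Γ.dist r b)
  · exact Or.inl (nearSplit_of_bipartite hq hq1 hr hbip)
  by_cases hw : (((component Γ r).filter fun v => g v ≠ v).card : ℝ) <
      (1 / 2 + 21 * q) * Fintype.card V
  · exact Or.inl (nearSplit_of_card_matched_lt hg hq hq1 hk hr hw)
  right
  intro t ht htk
  push Not at hbip hw
  obtain ⟨a, ha, b, hab, hpar⟩ := hbip
  have hpos : (0 : ℝ) < (1 / 2 + 21 * q) * Fintype.card V := by positivity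
  have hF : ∀ v ∈ (component Γ r).filter fun v => g v ≠ v, Γ.Adj v (g v) := fun v hv =>
    (hg.1 v).2.resolve_left (mem_filter.1 hv).2
  have h7 : (7 : ℝ) ≤ Fintype.card V := by
    have : 100 ≤ Fintype.card V * q := (div_le_iff₀ hq).1 hk
    nlinarith
  obtain ⟨p, hp, hc⟩ := exists_closed_walk_of_odd (fun v => (hg.1 v).1) hF
    (fun v hv => mem_component.1 (mem_filter.1 hv).1)
    (Finset.card_pos.1 (by exact_mod_cast hpos.trans_le hw)) (mem_component.1 ha) hab hpar ht htk
    (by exact_mod_cast h7)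
  refine ⟨r, p, hp, fun u => (hc u).trans ?_⟩
  gcongr

end Dichotomy

section ReducedCycle

variable {α : Type*} [Fintype α] {k : ℕ} {H : SimpleGraph α} {q : ℝ} {c : α → Fin k}

/-- A closed walk in the reduced graph that visits no cluster too often is followed by a cycle of
the same length. -/
lemma IsRegularLabelling.exists_cycle (h : IsRegularLabelling H (q ^ 2 / 100) c) (hq : 0 < q)
    (hq1 : q ≤ 1 / 10 ^ 10) (hm : 8 / q ≤ (Fintype.card α : ℝ) / k) {r : Fin k}
    (p : (reducedGraph H (q ^ 2 / 100) q c).Walk r r) (hp : 3 ≤ p.length)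
    (hc : ∀ v, q * ((Fintype.card α : ℝ) / k) / 2 + p.support.count v ≤
      (Fintype.card α : ℝ) / k - 1) :
    ∃ f : ZMod p.length → α, Function.Injective f ∧ ∀ i, H.Adj (f i) (f (i + 1)) := by
  set m : ℝ := (Fintype.card α : ℝ) / k with hm_def
  have hqm : 8 ≤ m * q := (div_le_iff₀ hq).1 hm
  have hm1 : 1 ≤ m := by nlinarith
  have hreg : ∀ a b, (reducedGraph H (q ^ 2 / 100) q c).Adj a b → ∀ Y ⊆ cluster c b,
      2 * (q ^ 2 / 100) * m ≤ Y.card →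
      (((cluster c a).filter fun x => ((Y.filter (H.Adj x)).card : ℝ) < q / 2 * Y.card).card : ℝ) <
        2 * (q ^ 2 / 100) * m := by
    intro a b hab Y hY hYc
    have hcard : ∀ i, ((cluster c i).card : ℝ) ≤ 2 * m := fun i => by
      linarith [h.card_le_real i]
    have hcard' : ∀ i, (q ^ 2 / 100) * ((cluster c i).card : ℝ) ≤ 2 * (q ^ 2 / 100) * m :=
      fun i => by
        calc (q ^ 2 / 100) * ((cluster c i).card : ℝ) ≤ (q ^ 2 / 100) * (2 * m) := by
              gcongr
              exact hcard i
          _ = 2 * (q ^ 2 / 100) * m := by ring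
    have hpos : (0 : ℝ) < (cluster c a).card := by
      have h1 := h.le_card_real a
      have h2 : 8 ≤ m := hqm.trans (by nlinarith)
      linarith
    have hlow := card_low_degree_lt (by positivity) hab.2.1 hab.2.2
      (Finset.card_pos.1 (by exact_mod_cast hpos)) hY ((hcard' b).trans hYc)
    refine lt_of_le_of_lt ?_ (hlow.trans_le (hcard' a))
    norm_cast
    refine Finset.card_le_card (Finset.monotone_filter_right _ fun x _ hx => ?_)
    refine lt_of_lt_of_le hx ?_
    gcongr
    nlinarith
  obtain ⟨x, y, l, hlen, hnd, hch, hyx⟩ := exists_cycle_of_closed_walk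
    (fun a b hab => disjoint_cluster c hab) (half_pos hq) (by positivity)
    (by nlinarith [mul_pos hq (one_pos.trans_le hm1)])
    (by nlinarith [mul_pos (mul_pos hq hq) (one_pos.trans_le hm1)])
    (by linarith : 1 ≤ q * m / 8) hreg p hp (by
      intro v
      have h1 := h.le_card_real v
      have h2 := hc v
      have h3 : 4 * (q * m / 8) + p.support.count v ≤ (cluster c v).card := by linarith
      convert h3)
  exact exists_zmod_cycle_of_list hnd hch hyx hlen

/-- A large graph of density nearly `1 / 2` either nearly splits or contains odd cycles longer than
half the number of vertices. -/
theorem exists_nearSplit_or_exists_cycle (hq : 0 < q) (hq1 : q ≤ 1 / 10 ^ 10) :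
    ∃ N : ℕ, ∀ (M : ℕ) (H : SimpleGraph (Fin M)), N ≤ M →
      1 / 2 - 13 * q ≤ (interPairs H univ univ : ℝ) / (M : ℝ) ^ 2 →
      NearSplit H (3 * √q + q) (32 * q) ∨ ∀ t : ℕ, Odd t → (t : ℝ) ≤ (1 / 2 + 20 * q) * M →
        (1 / 2 + 20 * q) * M - 2 < (t : ℝ) →
        ∃ f : ZMod t → Fin M, Function.Injective f ∧ ∀ i, H.Adj (f i) (f (i + 1)) := by
  set l := ⌈100 / q⌉₊ with hl_def
  set B := SzemerediRegularity.bound (q ^ 2 / 100) l with hB_def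
  refine ⟨max l ⌈1000 * (B : ℝ) ^ 3 / q⌉₊, fun M H hM hd => ?_⟩
  obtain ⟨k, hlk, hkB, c, hc⟩ := exists_isRegularLabelling H
    (ε := q ^ 2 / 100) (by positivity) (l := l)
    (by rw [Fintype.card_fin]; exact (le_max_left _ _).trans hM)
  have hk : 100 / q ≤ k := (Nat.le_ceil _).trans (by exact_mod_cast hlk)
  have hkq : 100 ≤ k * q := (div_le_iff₀ hq).1 hk
  have hk0 : (0 : ℝ) < k := lt_of_lt_of_le (by positivity) hk
  have hk100 : (100 : ℝ) ≤ k := by nlinarith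
  have hkB' : (k : ℝ) ≤ B := by exact_mod_cast hkB
  have hMk : 1000 * (k : ℝ) ^ 3 / q ≤ M := by
    calc 1000 * (k : ℝ) ^ 3 / q ≤ 1000 * (B : ℝ) ^ 3 / q := by gcongr
      _ ≤ (⌈1000 * (B : ℝ) ^ 3 / q⌉₊ : ℝ) := Nat.le_ceil _
      _ ≤ M := by exact_mod_cast (le_max_right _ _).trans hM
  have hMk' : 1000 * (k : ℝ) / q ≤ M := by
    refine le_trans ?_ hMk
    gcongr
    exact le_self_pow₀ (by linarith) (by norm_num)
  have hm : 1000 * (k : ℝ) ^ 2 ≤ q * ((M : ℝ) / k) := by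
    rw [div_le_iff₀ hq] at hMk
    rw [← mul_div_assoc, le_div_iff₀ hk0]
    linarith
  have hM0 : (0 : ℝ) < M := lt_of_lt_of_le (by positivity) hMk'
  have hε1 : q ^ 2 / 100 ≤ q / 8 := by nlinarith
  have hk8 : 8 / q ≤ k := le_trans (by gcongr; norm_num) hk
  have hdΓ := hc.le_interPairs_reducedGraph hq.le (by linarith) hq (by linarith) hε1 hk8
    (by rw [Fintype.card_fin]; exact hMk') (ρ := 1 / 2 - 13 * q)
    (by rw [Fintype.card_fin]; exact hd)
  rcases nearSplit_or_exists_closed_walk (Γ := reducedGraph H (q ^ 2 / 100) q c) hq hq1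
    (by rw [Fintype.card_fin]; exact hk)
    (by rw [Fintype.card_fin]; linarith) with hns | hwalk
  · left
    have h1 := hc.nearSplit hq.le (by linarith) hq (by linarith) hε1 hk8
      (by rw [Fintype.card_fin]; exact hMk') (σ := 3 * √q) (τ := 30 * q) (by convert hns)
    convert h1 using 1
    ring
  right
  intro t ht htM htM'
  rw [Fintype.card_fin] at hwalk
  have hm0 : (0 : ℝ) < (M : ℝ) / k := by positivity
  have hMm : (M : ℝ) = k * ((M : ℝ) / k) := by field_simp
  have hmk : 1000 * (k : ℝ) ^ 2 ≤ (M : ℝ) / k := hm.trans (by nlinarith)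
  have htk : (2 * (k : ℝ) ^ 2 + 2 * k) ≤ t := by
    have h1 : (M : ℝ) / k ≤ M := div_le_self hM0.le (by linarith)
    have h2 : 0 < q * M := by positivity
    nlinarith
  obtain ⟨r, p, rfl, hcount⟩ := hwalk t ht (by exact_mod_cast htk)
  refine hc.exists_cycle hq hq1 ?_ p ?_ fun v => ?_
  · rw [Fintype.card_fin, div_le_iff₀ hq]
    nlinarith
  · have : (3 : ℝ) ≤ p.length := by nlinarith
    exact_mod_cast this
  · rw [Fintype.card_fin]
    have h1 : (p.support.count v : ℝ) ≤
        p.length / ((1 / 2 + 21 * q) * k) + 3 * (k : ℝ) ^ 2 := by convert hcount v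
    have h2 : (p.length : ℝ) / ((1 / 2 + 21 * q) * k) ≤ (1 - q) * ((M : ℝ) / k) := by
      rw [div_le_iff₀ (by positivity)]
      refine htM.trans ?_
      calc (1 / 2 + 20 * q) * (M : ℝ) ≤ (1 - q) * (1 / 2 + 21 * q) * M := by
            gcongr
            nlinarith
        _ = (1 - q) * ((M : ℝ) / k) * ((1 / 2 + 21 * q) * k) := by field_simp
    have h3 : (1 : ℝ) ≤ (k : ℝ) ^ 2 := one_le_pow₀ (by linarith)
    linarith

end ReducedCycle

section Extremal

variable {n : ℕ} {G : SimpleGraph (Fin n)}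

/-- Numerical facts about the part sizes `a`, `b` of a balanced partition of `N` points. -/
lemma balanced_partition_bounds {a b N h q lam : ℝ} (hh : 0 < h) (hh1 : h ≤ 1 / 10 ^ 5)
    (hqh : q ≤ h / 10 ^ 5) (hN : 0 < N) (hlam : 1300 * h ≤ lam) (hsum : a + b = N)
    (ha : (1 / 2 - 4 * h) * N ≤ a) (hb : (1 / 2 - 4 * h) * N ≤ b) :
    0 < a ∧ 0 < b ∧ a ^ 2 + b ^ 2 ≤ N ^ 2 / 2 + h * N ^ 2 ∧ 100 * (q * N ^ 2) ≤ h * N ^ 2 ∧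
      10 * (h * N ^ 2) ≤ lam * a ^ 2 ∧ 10 * (h * N ^ 2) ≤ lam * b ^ 2 ∧
      10 * (h * N ^ 2) ≤ lam * (a * b) := by
  have hhN1 : h * N ≤ 1 / 10 ^ 5 * N := mul_le_mul_of_nonneg_right hh1 hN.le
  have ha0 : 49 / 100 * N ≤ a := by linarith
  have hb0 : 49 / 100 * N ≤ b := by linarith
  have hN2 : 0 < h * N ^ 2 := by positivity
  have key : ∀ x, 1 / 5 * N ^ 2 ≤ x → 10 * (h * N ^ 2) ≤ lam * x := by
    intro x hx
    calc 10 * (h * N ^ 2) ≤ 1300 * h * (1 / 5 * N ^ 2) := by linarith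
      _ ≤ lam * x := mul_le_mul hlam hx (by positivity) (by linarith)
  have hab : ∀ x y, 49 / 100 * N ≤ x → 49 / 100 * N ≤ y → 1 / 5 * N ^ 2 ≤ x * y := by
    intro x y hx hy
    calc 1 / 5 * N ^ 2 ≤ (49 / 100 * N) * (49 / 100 * N) := by
          linarith [sq_nonneg N]
      _ ≤ x * y := mul_le_mul hx hy (by positivity) (by linarith)
  have hdiff : (a - b) ^ 2 ≤ (8 * h * N) ^ 2 := by
    rw [sq_le_sq, abs_of_pos (by positivity : 0 < 8 * h * N), abs_le]
    constructor <;> linarith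
  have hhh : h * (h * N ^ 2) ≤ 1 / 10 ^ 5 * (h * N ^ 2) := mul_le_mul_of_nonneg_right hh1 hN2.le
  refine ⟨by linarith, by linarith, ?_, ?_, ?_, ?_, key _ (hab a b ha0 hb0)⟩
  · rw [← hsum] at hdiff hhh hN2 ⊢
    linarith
  · have := mul_le_mul_of_nonneg_right hqh (sq_nonneg N)
    linarith
  · rw [sq a]
    exact key _ (hab a a ha0 ha0)
  · rw [sq b]
    exact key _ (hab b b hb0 hb0)

/-- If few pairs cross a balanced partition of a graph of density at least nearly `1 / 2`, then both
parts are nearly complete and the complement is nearly complete between them. -/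
lemma le_dens_of_few_crossing {A : Finset (Fin n)} {h q lam : ℝ} (hh : 0 < h) (hh1 : h ≤ 1 / 10 ^ 5)
    (hqh : q ≤ h / 10 ^ 5) (hn : 0 < n) (hlam : 1300 * h ≤ lam)
    (hA : (1 / 2 - 4 * h) * n ≤ A.card) (hA' : (1 / 2 - 4 * h) * n ≤ Aᶜ.card)
    (hd : 1 / 2 - q ≤ (interPairs G univ univ : ℝ) / (n : ℝ) ^ 2)
    (hcross : (interPairs G A Aᶜ : ℝ) / (n : ℝ) ^ 2 ≤ 44 * q) :
    1 - lam ≤ densIn G A ∧ 1 - lam ≤ densIn G Aᶜ ∧ 1 - lam ≤ dens Gᶜ A Aᶜ := by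
  have hn0 : (0 : ℝ) < n := by exact_mod_cast hn
  have hsum : (A.card : ℝ) + Aᶜ.card = n := by
    exact_mod_cast (Finset.card_add_card_compl A).trans (Fintype.card_fin n)
  rw [div_le_iff₀ (by positivity)] at hcross
  rw [le_div_iff₀ (by positivity), interPairs_univ_split G A] at hd
  push_cast at hd
  have hAA : (interPairs G A A : ℝ) ≤ A.card * A.card := by
    exact_mod_cast interPairs_le_mul G A A
  have hBB : (interPairs G Aᶜ Aᶜ : ℝ) ≤ Aᶜ.card * Aᶜ.card := by
    exact_mod_cast interPairs_le_mul G Aᶜ Aᶜ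
  have hAB : (interPairs G A Aᶜ : ℝ) + interPairs Gᶜ A Aᶜ = A.card * Aᶜ.card := by
    exact_mod_cast interPairs_add_compl G (disjoint_compl_right (a := A))
  obtain ⟨ha0, hb0, hab2, hqN, hla, hlb, hlab⟩ :=
    balanced_partition_bounds hh hh1 hqh hn0 hlam hsum hA hA'
  have hN2 : 0 < h * (n : ℝ) ^ 2 := by positivity
  unfold densIn _root_.dens
  refine ⟨?_, ?_, ?_⟩
  · rw [le_div_iff₀ (by positivity)]
    linarith
  · rw [le_div_iff₀ (by positivity)]
    linarith
  · rw [le_div_iff₀ (by positivity)]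
    linarith

/-- If few pairs lie inside the parts of a balanced partition of a graph of density at least nearly
`1 / 2`, then both parts are nearly empty and the graph is nearly complete between them. -/
lemma le_dens_of_few_inside {A : Finset (Fin n)} {h q lam : ℝ} (hh : 0 < h) (hh1 : h ≤ 1 / 10 ^ 5)
    (hqh : q ≤ h / 10 ^ 5) (hq0 : 0 < q) (hn : 1 / q ≤ n) (hlam : 1300 * h ≤ lam)
    (hA : (1 / 2 - 4 * h) * n ≤ A.card) (hA' : (1 / 2 - 4 * h) * n ≤ Aᶜ.card)
    (hd : 1 / 2 - q ≤ (interPairs G univ univ : ℝ) / (n : ℝ) ^ 2)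
    (hin : (interPairs G A A : ℝ) / (n : ℝ) ^ 2 ≤ 44 * q)
    (hin' : (interPairs G Aᶜ Aᶜ : ℝ) / (n : ℝ) ^ 2 ≤ 44 * q) :
    1 - lam ≤ densIn Gᶜ A ∧ 1 - lam ≤ densIn Gᶜ Aᶜ ∧ 1 - lam ≤ dens G A Aᶜ := by
  have hn0 : (0 : ℝ) < n := lt_of_lt_of_le (by positivity) hn
  have hsum : (A.card : ℝ) + Aᶜ.card = n := by
    exact_mod_cast (Finset.card_add_card_compl A).trans (Fintype.card_fin n)
  rw [div_le_iff₀ (by positivity)] at hin hin'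
  rw [le_div_iff₀ (by positivity), interPairs_univ_split G A] at hd
  push_cast at hd
  have hAA : (interPairs G A A : ℝ) + interPairs Gᶜ A A + A.card = A.card * A.card := by
    exact_mod_cast interPairs_self_add_compl G A
  have hBB : (interPairs G Aᶜ Aᶜ : ℝ) + interPairs Gᶜ Aᶜ Aᶜ + Aᶜ.card = Aᶜ.card * Aᶜ.card := by
    exact_mod_cast interPairs_self_add_compl G Aᶜ
  obtain ⟨ha0, hb0, hab2, hqN, hla, hlb, hlab⟩ :=
    balanced_partition_bounds hh hh1 hqh hn0 hlam hsum hA hA'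
  have hN2 : 0 < h * (n : ℝ) ^ 2 := by positivity
  have hnq : (n : ℝ) ≤ q * (n : ℝ) ^ 2 := by
    rw [div_le_iff₀ hq0] at hn
    nlinarith
  have hab : 4 * ((A.card : ℝ) * Aᶜ.card) ≤ (n : ℝ) ^ 2 := by
    rw [← hsum]
    linarith [sq_nonneg ((A.card : ℝ) - Aᶜ.card)]
  unfold densIn _root_.dens
  refine ⟨?_, ?_, ?_⟩
  · rw [le_div_iff₀ (by positivity)]
    linarith
  · rw [le_div_iff₀ (by positivity)]
    linarith
  · rw [le_div_iff₀ (by positivity)]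
    linarith

lemma isExtremalColoring_of_nearSplit {R : SimpleGraph (Fin n)} {χ : Bool} {h q lam : ℝ}
    (hh : 0 < h) (hh1 : h ≤ 1 / 10 ^ 5) (hqh : q ≤ h / 10 ^ 5) (hq0 : 0 < q) (hn : 1 / q ≤ n)
    (hlam : 1300 * h ≤ lam)
    (hd : 1 / 2 - q ≤ (interPairs (colorGraph R χ) univ univ : ℝ) / (n : ℝ) ^ 2)
    (hs : NearSplit (colorGraph R χ) (4 * h) (44 * q)) : IsExtremalColoring R lam := by
  obtain ⟨A, hA, hA', hor⟩ := hs
  rw [Fintype.card_fin] at hA hA' hor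
  have hn0 : (0 : ℝ) < n := lt_of_lt_of_le (by positivity) hn
  have hle : (1 / 2 - lam) * (n : ℝ) ≤ (1 / 2 - 4 * h) * n := by
    gcongr
    linarith
  refine ⟨A, Aᶜ, disjoint_compl_right, Finset.union_compl A, hle.trans hA, hle.trans hA', ?_⟩
  rcases hor with hc | ⟨hi, hi'⟩
  · have := le_dens_of_few_crossing hh hh1 hqh (by exact_mod_cast hn0) hlam hA hA' hd hc
    cases χ
    · right
      simpa [colorGraph] using this
    · left
      simpa [colorGraph] using this
  · have := le_dens_of_few_inside hh hh1 hqh hq0 hn hlam hA hA' hd hi hi'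
    cases χ
    · left
      simpa [colorGraph] using this
    · right
      simpa [colorGraph] using this

/-- One of the two colors contains nearly half of the ordered pairs. -/
lemma exists_le_interPairs_colorGraph (R : SimpleGraph (Fin n)) {q : ℝ} (hq : 0 < q)
    (hn : 1 / q ≤ n) :
    ∃ χ, 1 / 2 - q ≤ (interPairs (colorGraph R χ) univ univ : ℝ) / (n : ℝ) ^ 2 := by
  have hn0 : (0 : ℝ) < n := lt_of_lt_of_le (by positivity) hn
  have h := interPairs_self_add_compl R univ
  rw [Finset.card_univ, Fintype.card_fin] at h
  have hR : (interPairs R univ univ : ℝ) + interPairs Rᶜ univ univ + n = n * n := by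
    exact_mod_cast h
  have hnq : (n : ℝ) ≤ q * (n : ℝ) ^ 2 := by
    rw [div_le_iff₀ hq] at hn
    nlinarith
  by_cases hle : (1 / 2 - q) * (n : ℝ) ^ 2 ≤ interPairs R univ univ
  · refine ⟨true, ?_⟩
    rw [le_div_iff₀ (by positivity)]
    simpa [colorGraph] using hle
  · refine ⟨false, ?_⟩
    rw [le_div_iff₀ (by positivity)]
    have : (1 / 2 - q) * (n : ℝ) ^ 2 ≤ interPairs Rᶜ univ univ := by linarith
    simpa [colorGraph] using this

end Extremal

theorem stmt_1 (ε : ℝ) (hε0 : 0 < ε) (hε : ε < (10 : ℝ) ^ (-20 : ℤ)) :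
    ∃ M₀ : ℕ, ∃ N : ℕ, ∀ n : ℕ, N ≤ n → ∀ R : SimpleGraph (Fin n),
      (∃ M : ℕ, ε⁻¹ ≤ (M : ℝ) ∧ M ≤ M₀ ∧
        ∀ t : ℕ, Odd t →
          (t : ℝ) ≤ (1 / 2 + 20 * Real.sqrt ε) * M →
          (1 / 2 + 20 * Real.sqrt ε) * M - 2 < (t : ℝ) →
          ∃ (Vs : ZMod t → Finset (Fin n)) (χ : Bool),
            (∀ i j : ZMod t, i ≠ j → Disjoint (Vs i) (Vs j)) ∧
            ∀ i : ZMod t,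
              n / M ≤ (Vs i).card ∧
              IsRegularPair (colorGraph R χ) ε (Vs i) (Vs (i + 1)) ∧
              11 * Real.sqrt ε ≤ dens (colorGraph R χ) (Vs i) (Vs (i + 1))) ∨
      IsExtremalColoring R (300 * Real.sqrt (20 * Real.sqrt ε)) := by
  set q := Real.sqrt ε with hq_def
  have hq : 0 < q := Real.sqrt_pos.2 hε0
  have hqε : q ^ 2 = ε := Real.sq_sqrt hε0.le
  have hq1 : q ≤ 1 / 10 ^ 10 := by
    rw [hq_def, Real.sqrt_le_left (by positivity)]
    refine hε.le.trans (le_of_eq ?_)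
    norm_num
  obtain ⟨hh0, hh1, hh2⟩ := sq_sqrt_le_div_of_le hq hq1
  have hqh : q ≤ √q / 10 ^ 5 := by
    calc q = √q * √q := by rw [← sq, hh2]
      _ ≤ √q * (1 / 10 ^ 5) := by gcongr
      _ = √q / 10 ^ 5 := by ring
  have hlam : 1300 * √q ≤ 300 * √(20 * q) := by
    rw [Real.sqrt_mul (by norm_num)]
    have : 13 / 3 ≤ √20 := Real.le_sqrt_of_sq_le (by norm_num)
    nlinarith
  obtain ⟨N₁, hN₁⟩ := exists_nearSplit_or_exists_cycle hq hq1
  set l := max N₁ (max ⌈ε⁻¹⌉₊ ⌈8 / q⌉₊)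
  set M₀ := SzemerediRegularity.bound ε l
  refine ⟨M₀, max l (max ⌈1000 * (M₀ : ℝ) / q⌉₊ ⌈1 / q⌉₊), fun n hn R => ?_⟩
  have hnl : l ≤ n := (le_max_left _ _).trans hn
  have hnM₀ : 1000 * (M₀ : ℝ) / q ≤ n := (Nat.le_ceil _).trans
    (by exact_mod_cast (le_max_left _ _).trans ((le_max_right _ _).trans hn))
  have hnq : 1 / q ≤ n := (Nat.le_ceil _).trans
    (by exact_mod_cast (le_max_right _ _).trans ((le_max_right _ _).trans hn))
  obtain ⟨χ, hχ⟩ := exists_le_interPairs_colorGraph R hq hnq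
  obtain ⟨M, hlM, hMM₀, c, hc⟩ := exists_isRegularLabelling (colorGraph R χ) hε0 (l := l)
    (by rwa [Fintype.card_fin])
  have hMε : ε⁻¹ ≤ (M : ℝ) := (Nat.le_ceil _).trans
    (by exact_mod_cast (le_max_left _ _).trans ((le_max_right _ _).trans hlM))
  have hM8 : 8 / q ≤ (M : ℝ) := (Nat.le_ceil _).trans
    (by exact_mod_cast (le_max_right _ _).trans ((le_max_right _ _).trans hlM))
  have hnM : 1000 * (M : ℝ) / q ≤ (Fintype.card (Fin n) : ℕ) := by
    rw [Fintype.card_fin]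
    refine le_trans ?_ hnM₀
    gcongr
  have hε8 : ε ≤ q / 8 := by
    rw [← hqε]
    nlinarith
  have hdH := hc.le_interPairs_reducedGraph (d := 11 * q) (by positivity) (by linarith) hq
    (by linarith) hε8 hM8 hnM (ρ := 1 / 2 - q) (by rwa [Fintype.card_fin])
  rcases hN₁ M (reducedGraph (colorGraph R χ) ε (11 * q) c) ((le_max_left _ _).trans hlM)
    (by linarith) with hs | hcyc
  · right
    have h1 := hc.nearSplit (by positivity) (by linarith) hq (by linarith) hε8 hM8 hnM hs
    obtain ⟨A, hA, hA', hor⟩ := h1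
    have hσ : (1 / 2 - 4 * √q) * (Fintype.card (Fin n) : ℝ) ≤
        (1 / 2 - (3 * √q + q + q)) * (Fintype.card (Fin n) : ℝ) := by
      gcongr
      linarith
    have hτ : 32 * q + 11 * q + q = 44 * q := by ring
    rw [hτ] at hor
    exact isExtremalColoring_of_nearSplit hh0 hh1 hqh hq hnq hlam hχ
      ⟨A, hσ.trans hA, hσ.trans hA', hor⟩
  · refine Or.inl ⟨M, hMε, hMM₀, fun t ht htM htM' => ?_⟩
    obtain ⟨f, hf, hadj⟩ := hcyc t ht htM htM'
    refine ⟨fun i => cluster c (f i), χ, fun i j hij => disjoint_cluster c (hf.ne hij),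
      fun i => ⟨?_, (hadj i).2.1, (hadj i).2.2⟩⟩
    have := hc.le_card (f i)
    rwa [Fintype.card_fin] at this
end
end

section
/- Suppose 0 < ε < 10^{-5} and t, n are integers with t ≥ 2 and n ≥ ε^{-2}. Suppose V_0, …, V_{t−1} are disjoint vertex sets in a graph, indexed by the elements of Z/tZ, such that for each i ∈ Z/tZ: |V_i| ≥ n, the pair (V_i, V_{i+1}) is ε-regular, and d(V_i, V_{i+1}) ≥ d for some d ≥ 5ε^{1/2}. Then for any integer ℓ divisible by t with 4 ≤ ℓ ≤ t(1−3√ε)n, and any two (not necessarily distinct) vertices w_0, w_0' ∈ V_0 such that w_0 has at least (d−ε)|V_1| neighbors in V_1 and w_0' has at least (d−ε)|V_{t−1}| neighbors in V_{t−1}, the number of (V_0, …, V_{t−1})-transversal paths of length ℓ with end vertices w_0 and w_0' is at least (d − 5√ε)^{ℓ−1} · (1 − 2√ε)^{ℓ−2} · (εn) · ∏_{i=1}^{ℓ−2} (n − ⌊i/t⌋). -/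
open Finset
open scoped Classical

noncomputable section

/-- The number of `(V_0, …, V_{t-1})`-transversal paths of length `ℓ` with end vertices `w₀`
and `w₀'`: sequences `w_0 = w₀, w_1, …, w_ℓ = w₀'` with consecutive vertices adjacent,
`w_i ∈ V_{i mod t}` for all `i`, and all vertices distinct except that the two end vertices
are allowed to coincide. -/
def transversalPathsBetween {V : Type*} (G : SimpleGraph V) {t : ℕ}
    (Vs : ZMod t → Finset V) (ℓ : ℕ) (w₀ w₀' : V) : ℕ :=
  Nat.card {w : Fin (ℓ + 1) → V // w 0 = w₀ ∧ w (Fin.last ℓ) = w₀' ∧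
    (∀ i j : Fin (ℓ + 1), w i = w j →
      i = j ∨ (i = 0 ∧ j = Fin.last ℓ) ∨ (i = Fin.last ℓ ∧ j = 0)) ∧
    (∀ i : Fin ℓ, G.Adj (w i.castSucc) (w i.succ)) ∧
    ∀ i : Fin (ℓ + 1), w i ∈ Vs ((i : ℕ) : ZMod t)}

/-- In a regular pair of density at least `d`, few vertices of `X` have fewer than `(d - ε) |B|`
neighbours in a large subset `B` of `Y`. -/
theorem IsRegularPair.card_low_degree_le {V : Type*} {G : SimpleGraph V} {ε d : ℝ}
    {X Y B : Finset V} (hreg : IsRegularPair G ε X Y) (hd : d ≤ dens G X Y) (hε : 0 < ε)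
    (hX : 0 < X.card) (hBY : B ⊆ Y) (hB : ε * Y.card ≤ B.card) (hB0 : 0 < B.card) :
    ((X.filter fun x => ((B.filter fun v => G.Adj x v).card : ℝ) < (d - ε) * B.card).card : ℝ) ≤
      ε * X.card := by
  set U := X.filter fun x => ((B.filter fun v => G.Adj x v).card : ℝ) < (d - ε) * B.card with hU
  by_contra! h
  have hX' : (0 : ℝ) < X.card := by exact_mod_cast hX
  have hU0 : (0 : ℝ) < U.card := lt_trans (by positivity) h
  have hB0' : (0 : ℝ) < B.card := by exact_mod_cast hB0
  have hne : U.Nonempty := card_pos.1 (by exact_mod_cast hU0)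
  have hUB := (abs_le.1 (hreg U (filter_subset _ _) B hBY h.le hB)).1
  have hdUB : d - ε ≤ _root_.dens G U B := by linarith
  have hcount : (interPairs G U B : ℝ) = ∑ x ∈ U, ((B.filter fun v => G.Adj x v).card : ℝ) := by
    unfold interPairs
    rw [card_filter, sum_product]
    push_cast
    refine sum_congr rfl fun x _ => ?_
    rw [card_filter]
    push_cast
    rfl
  have hlt : (interPairs G U B : ℝ) < U.card * ((d - ε) * B.card) := by
    rw [hcount, ← nsmul_eq_mul, ← sum_const]
    exact sum_lt_sum_of_nonempty hne fun x hx => (mem_filter.1 hx).2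
  unfold _root_.dens at hdUB
  rw [le_div_iff₀ (by positivity)] at hdUB
  nlinarith

/-- `w` restricted to `{0, …, k}` starts at `w₀` and is a transversal path which, apart from its
starting vertex, avoids `F` and does not repeat vertices. -/
structure IsPrefix {V : Type*} (G : SimpleGraph V) {t : ℕ} (Vs : ZMod t → Finset V)
    (F : Finset V) (w₀ : V) (k : ℕ) (w : ℕ → V) : Prop where
  zero : w 0 = w₀
  mem : ∀ i, 1 ≤ i → i ≤ k → w i ∈ Vs (i : ZMod t)
  avoid : ∀ i, 1 ≤ i → i ≤ k → w i ∉ F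
  inj : ∀ i j, 1 ≤ i → i ≤ k → 1 ≤ j → j ≤ k → w i = w j → i = j
  adj : ∀ i, i < k → G.Adj (w i) (w (i + 1))

/-- The vertices of the `i`-th part which avoid `F` and `w 1, …, w k`. -/
def avail {V : Type*} {t : ℕ} (Vs : ZMod t → Finset V) (F : Finset V) (i k : ℕ) (w : ℕ → V) :
    Finset V :=
  Vs (i : ZMod t) \ (F ∪ (Icc 1 k).image w)

theorem IsPrefix.update {V : Type*} {G : SimpleGraph V} {t : ℕ} {Vs : ZMod t → Finset V}
    {F : Finset V} {w₀ : V} {k : ℕ} {w : ℕ → V} (h : IsPrefix G Vs F w₀ k w) {x : V}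
    (hx : x ∈ avail Vs F (k + 1) k w) (hadj : G.Adj (w k) x) :
    IsPrefix G Vs F w₀ (k + 1) (Function.update w (k + 1) x) := by
  simp only [avail, mem_sdiff, mem_union, mem_image, mem_Icc, not_or, not_exists, not_and] at hx
  obtain ⟨hxV, hxF, hxw⟩ := hx
  have hne : ∀ i, i ≤ k → Function.update w (k + 1) x i = w i := fun i hi =>
    Function.update_of_ne (by omega) _ _
  have hself : Function.update w (k + 1) x (k + 1) = x := Function.update_self _ _ _
  refine ⟨by rw [hne 0 (by omega), h.zero], fun i h1 hi => ?_, fun i h1 hi => ?_,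
    fun i j hi1 hi hj1 hj he => ?_, fun i hi => ?_⟩
  · rcases Nat.le_succ_iff.1 hi with hi | rfl
    · rw [hne i hi]; exact h.mem i h1 hi
    · rw [hself]; exact hxV
  · rcases Nat.le_succ_iff.1 hi with hi | rfl
    · rw [hne i hi]; exact h.avoid i h1 hi
    · rw [hself]; exact hxF
  · rcases Nat.le_succ_iff.1 hi with hi | rfl <;> rcases Nat.le_succ_iff.1 hj with hj | rfl
    · rw [hne i hi, hne j hj] at he
      exact h.inj i j hi1 hi hj1 hj he
    · rw [hne i hi, hself] at he
      exact absurd he (hxw i ⟨hi1, hi⟩)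
    · rw [hne j hj, hself] at he
      exact absurd he.symm (hxw j ⟨hj1, hj⟩)
    · rfl
  · rcases Nat.lt_succ_iff_lt_or_eq.1 hi with hi | rfl
    · rw [hne i hi.le, hne (i + 1) hi]; exact h.adj i hi
    · rw [hne i le_rfl, hself]; exact hadj

/-- Appending a vertex of the part `k + 1` does not affect availability in the part `k + 2`. -/
theorem avail_update {V : Type*} {t : ℕ} (ht : 2 ≤ t) {Vs : ZMod t → Finset V}
    (hdisj : ∀ i j : ZMod t, i ≠ j → Disjoint (Vs i) (Vs j)) (F : Finset V) (k : ℕ) (w : ℕ → V)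
    {x : V} (hx : x ∈ Vs ((k + 1 : ℕ) : ZMod t)) :
    avail Vs F (k + 2) (k + 1) (Function.update w (k + 1) x) = avail Vs F (k + 2) k w := by
  have : Fact (1 < t) := ⟨ht⟩
  have hne : ((k + 1 : ℕ) : ZMod t) ≠ ((k + 2 : ℕ) : ZMod t) := by
    intro h
    push_cast at h
    have h1 : (1 : ZMod t) = 0 := by linear_combination -h
    exact one_ne_zero h1
  ext y
  simp only [avail, mem_sdiff, mem_union, mem_image, mem_Icc, not_or, not_exists, not_and]
  refine and_congr_right fun hy => and_congr_right fun _ => ⟨fun h i hi => ?_, fun h i hi => ?_⟩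
  · have := h i ⟨hi.1, by omega⟩
    rwa [Function.update_of_ne (by omega)] at this
  · rcases Nat.le_succ_iff.1 hi.2 with hi' | rfl
    · rw [Function.update_of_ne (by omega)]
      exact h i ⟨hi.1, hi'⟩
    · rw [Function.update_self]
      rintro rfl
      exact disjoint_left.1 (hdisj _ _ hne) hx hy

/-- At most `⌊i / t⌋` positive integers below `i` are congruent to `i` modulo `t`. -/
theorem card_filter_modEq_le (t i : ℕ) (ht : 0 < t) :
    ((Icc 1 (i - 1)).filter fun j => j ≡ i [MOD t]).card ≤ i / t := by
  rw [← card_range (i / t)]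
  refine card_le_card_of_injOn (fun j => j / t) (fun j hj => ?_) fun j hj j' hj' he => ?_
  · simp only [coe_filter, mem_Icc, Set.mem_ofPred_eq] at hj
    simp only [coe_range, Set.mem_Iio]
    obtain ⟨⟨h1, h2⟩, h3⟩ := hj
    have hdvd : t ∣ i - j := (Nat.modEq_iff_dvd' (by omega)).1 h3
    have hle : t ≤ i - j := Nat.le_of_dvd (by omega) hdvd
    have h4 : j / t + 1 = (j + t) / t := (Nat.add_div_right j ht).symm
    have h5 : (j + t) / t ≤ i / t := Nat.div_le_div_right (by omega)
    omega
  · simp only [coe_filter, mem_Icc, Set.mem_ofPred_eq] at hj hj'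
    have hmod : j % t = j' % t := hj.2.trans hj'.2.symm
    have h1 := Nat.div_add_mod j t
    have h2 := Nat.div_add_mod j' t
    simp only at he
    rw [← h1, ← h2, he, hmod]

theorem card_avail_ge {V : Type*} {t : ℕ} (ht : 0 < t) {Vs : ZMod t → Finset V}
    (hdisj : ∀ i j : ZMod t, i ≠ j → Disjoint (Vs i) (Vs j)) (F : Finset V) {i k : ℕ} {w : ℕ → V}
    (hki : k < i) (hw : ∀ j, 1 ≤ j → j ≤ k → w j ∈ Vs (j : ZMod t)) :
    (Vs (i : ZMod t)).card ≤
      (avail Vs F i k w).card + (Vs (i : ZMod t) ∩ F).card + i / t := by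
  have hsub : Vs (i : ZMod t) ⊆ (avail Vs F i k w ∪ (Vs (i : ZMod t) ∩ F)) ∪
      ((Icc 1 (i - 1)).filter fun j => j ≡ i [MOD t]).image w := by
    intro y hy
    by_cases hyF : y ∈ F
    · simp [hyF, hy]
    by_cases hyw : y ∈ (Icc 1 k).image w
    · obtain ⟨j, hj, rfl⟩ := mem_image.1 hyw
      rw [mem_Icc] at hj
      refine mem_union_right _ (mem_image_of_mem w ?_)
      rw [mem_filter, mem_Icc, ← ZMod.natCast_eq_natCast_iff]
      refine ⟨⟨hj.1, by omega⟩, ?_⟩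
      by_contra hne
      exact disjoint_left.1 (hdisj _ _ hne) (hw j hj.1 hj.2) hy
    · refine mem_union_left _ (mem_union_left _ ?_)
      simp only [avail, mem_sdiff, mem_union, not_or]
      exact ⟨hy, hyF, hyw⟩
  calc (Vs (i : ZMod t)).card ≤ _ := card_le_card hsub
    _ ≤ _ := card_union_le _ _
    _ ≤ _ := add_le_add (card_union_le _ _) (card_image_le.trans (card_filter_modEq_le t i ht))

/-- If every sequence in `S`, constant equal to `a` after position `k`, can be extended in at
least `c` ways, then the extensions form a family of size at least `|S| * c`. -/
theorem exists_extension_family {V : Type*} (a : V) (k : ℕ) (P Q : (ℕ → V) → Prop) (c : ℝ)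
    (S : Finset (ℕ → V)) (hS : ∀ w ∈ S, P w ∧ ∀ j, k < j → w j = a)
    (step : ∀ w, P w → ∃ C : Finset V, c ≤ C.card ∧ ∀ x ∈ C, Q (Function.update w (k + 1) x)) :
    ∃ S' : Finset (ℕ → V), (S.card : ℝ) * c ≤ S'.card ∧
      ∀ w ∈ S', Q w ∧ ∀ j, k + 1 < j → w j = a := by
  choose! C hC hQ using step
  refine ⟨(S.sigma C).image fun p => Function.update p.1 (k + 1) p.2, ?_, ?_⟩
  · rw [card_image_of_injOn, card_sigma, ← nsmul_eq_mul, ← sum_const]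
    · push_cast
      exact sum_le_sum fun w hw => hC w (hS w hw).1
    · rintro ⟨w, x⟩ hp ⟨w', x'⟩ hp' he
      simp only [coe_sigma, Set.mem_sigma_iff, mem_coe] at hp hp'
      simp only at he
      have hx : x = x' := by simpa using congrFun he (k + 1)
      have hw : w = w' := by
        funext j
        by_cases hj : j = k + 1
        · rw [(hS w hp.1).2 j (by omega), (hS w' hp'.1).2 j (by omega)]
        · simpa [hj] using congrFun he j
      rw [hx, hw]
  · intro w' hw'
    obtain ⟨⟨w, x⟩, hp, rfl⟩ := mem_image.1 hw'
    rw [mem_sigma] at hp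
    refine ⟨hQ w (hS w hp.1).1 x hp.2, fun j hj => ?_⟩
    rw [Function.update_of_ne (by omega)]
    exact (hS w hp.1).2 j (by omega)

/-- Size estimates for the available part of a vertex class. -/
theorem available_size_bounds {s v n q a : ℝ} (hs0 : 0 < s) (hs : s < 1 / 300)
    (hvn : n ≤ v) (hn : 300 ≤ s ^ 2 * n) (hq : q ≤ (1 - 3 * s) * n)
    (ha : v ≤ a + (s ^ 2 * v + 3) + q) :
    (1 - 2 * s) * (n - q) ≤ a ∧ s * v ≤ a := by
  have h1 : s ^ 2 * n ≤ s ^ 2 * v := by gcongr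
  have hn0 : 0 < n := by
    by_contra! h
    nlinarith [sq_nonneg s]
  have h2 : 3 * s * v ≤ v - q := by nlinarith
  have h3 : s * (3 * s * v) ≤ s * (v - q) := by gcongr
  constructor
  · nlinarith
  · have h4 : s * (s * v) ≤ 1 / 300 * (s * v) := by
      apply mul_le_mul_of_nonneg_right hs.le
      exact mul_nonneg hs0.le (by linarith)
    nlinarith

/-- The possible next vertices of a path which leave many continuations into `B`. -/
theorem exists_extension_set {V : Type*} {G : SimpleGraph V} {s d : ℝ} {X Y A B : Finset V} {u : V}
    (hs0 : 0 < s) (hreg : IsRegularPair G (s ^ 2) X Y) (hd : d ≤ dens G X Y) (hX : 0 < X.card)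
    (hBY : B ⊆ Y) (hB : s ^ 2 * Y.card ≤ B.card) (hB0 : 0 < B.card)
    (hAX : A ⊆ X) (hA : s * X.card ≤ A.card)
    (hu : (d - 2 * s) * A.card ≤ (A.filter fun v => G.Adj u v).card) :
    ∃ C : Finset V, (d - 5 * s) * A.card ≤ C.card ∧ ∀ x ∈ C, x ∈ A ∧ G.Adj u x ∧
      (d - s ^ 2) * B.card ≤ (B.filter fun v => G.Adj x v).card := by
  set L := X.filter fun x => ((B.filter fun v => G.Adj x v).card : ℝ) < (d - s ^ 2) * B.card
    with hL
  have hLc : (L.card : ℝ) ≤ s ^ 2 * X.card :=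
    hreg.card_low_degree_le hd (by positivity) hX hBY hB hB0
  refine ⟨(A.filter fun v => G.Adj u v) \ L, ?_, fun x hx => ?_⟩
  · have h1 : ((A.filter fun v => G.Adj u v).card : ℝ) ≤
        ((A.filter fun v => G.Adj u v) \ L).card + L.card := by
      have := le_card_sdiff L (A.filter fun v => G.Adj u v)
      exact_mod_cast (by omega : (A.filter fun v => G.Adj u v).card ≤
        ((A.filter fun v => G.Adj u v) \ L).card + L.card)
    have h2 : s * (s * X.card) ≤ s * A.card := by gcongr
    have h3 : (0 : ℝ) ≤ s * A.card := by positivity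
    nlinarith
  · rw [mem_sdiff, mem_filter] at hx
    refine ⟨hx.1.1, hx.1.2, ?_⟩
    by_contra! hlt
    exact hx.2 (mem_filter.2 ⟨hAX hx.1.1, hlt⟩)

/-- A path prefix which can be continued inside the available vertices in many ways. -/
def IsGoodPrefix {V : Type*} (G : SimpleGraph V) {t : ℕ} (Vs : ZMod t → Finset V)
    (F : Finset V) (w₀ : V) (D : ℝ) (k : ℕ) (w : ℕ → V) : Prop :=
  IsPrefix G Vs F w₀ k w ∧ D * (avail Vs F (k + 1) k w).card ≤
    ((avail Vs F (k + 1) k w).filter fun v => G.Adj (w k) v).card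

/-- A prefix ending in a neighbour of `R`, closed up through a vertex of `R ⊆ N(w₀')`, is a
transversal path from `w₀` to `w₀'`. -/
theorem IsPrefix.close {V : Type*} {G : SimpleGraph V} {t m : ℕ} (ht : 2 ≤ t)
    {Vs : ZMod t → Finset V} (hdisj : ∀ i j : ZMod t, i ≠ j → Disjoint (Vs i) (Vs j))
    (hℓ0 : ((m + 3 : ℕ) : ZMod t) = 0) (hℓ1 : ((m + 2 : ℕ) : ZMod t) = -1)
    {w₀ w₀' : V} (hw₀ : w₀ ∈ Vs 0) (hw₀' : w₀' ∈ Vs 0)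
    {R : Finset V} (hRV : R ⊆ Vs (-1)) (hRadj : ∀ x ∈ R, G.Adj w₀' x) {w : ℕ → V}
    (hpre : IsPrefix G Vs (R ∪ {w₀, w₀'}) w₀ (m + 1) w) (hR : w (m + 2) ∈ R)
    (hadj : G.Adj (w (m + 1)) (w (m + 2))) (hlast : w (m + 3) = w₀') :
    w 0 = w₀ ∧ w (m + 3) = w₀' ∧
      (∀ i j, i ≤ m + 3 → j ≤ m + 3 → w i = w j →
        i = j ∨ (i = 0 ∧ j = m + 3) ∨ (i = m + 3 ∧ j = 0)) ∧
      (∀ i, i < m + 3 → G.Adj (w i) (w (i + 1))) ∧ ∀ i, i ≤ m + 3 → w i ∈ Vs (i : ZMod t) := by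
  have : Fact (1 < t) := ⟨ht⟩
  have hm10 : (-1 : ZMod t) ≠ 0 := by simp
  have hcases : ∀ i, i ≤ m + 3 → i = 0 ∨ (1 ≤ i ∧ i ≤ m + 1) ∨ i = m + 2 ∨ i = m + 3 := by omega
  have hmid : ∀ i, 1 ≤ i → i ≤ m + 1 → w i ∉ R ∧ w i ≠ w₀ ∧ w i ≠ w₀' := by
    intro i h1 h2
    have := hpre.avoid i h1 h2
    rw [mem_union, not_or] at this
    simpa using this
  have hR0 : ∀ x ∈ Vs 0, x ∉ R := fun x hx hxR =>
    disjoint_left.1 (hdisj _ _ hm10) (hRV hxR) hx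
  have hRw₀ := hR0 w₀ hw₀
  have hRw₀' := hR0 w₀' hw₀'
  have hzero := hpre.zero
  refine ⟨hzero, hlast, fun i j hi hj he => ?_, fun i hi => ?_, fun i hi => ?_⟩
  · rcases hcases i hi with rfl | ⟨h1, h2⟩ | rfl | rfl <;>
      rcases hcases j hj with rfl | ⟨h3, h4⟩ | rfl | rfl
    all_goals try omega
    · exact absurd (he.symm.trans hzero) (hmid j h3 h4).2.1
    · exact absurd ((he.symm.trans hzero) ▸ hR : w₀ ∈ R) hRw₀
    · exact absurd (he.trans hzero) (hmid i h1 h2).2.1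
    · exact Or.inl (hpre.inj i j h1 h2 h3 h4 he)
    · exact absurd (he ▸ hR) (hmid i h1 h2).1
    · exact absurd (he.trans hlast) (hmid i h1 h2).2.2
    · exact absurd ((he.trans hzero) ▸ hR : w₀ ∈ R) hRw₀
    · exact absurd (he ▸ hR) (hmid j h3 h4).1
    · exact absurd ((he.trans hlast) ▸ hR : w₀' ∈ R) hRw₀'
    · exact absurd (he.symm.trans hlast) (hmid j h3 h4).2.2
    · exact absurd ((he.symm.trans hlast) ▸ hR : w₀' ∈ R) hRw₀'
  · rcases (by omega : i < m + 1 ∨ i = m + 1 ∨ i = m + 2) with h | rfl | rfl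
    · exact hpre.adj i h
    · exact hadj
    · rw [hlast]; exact (hRadj _ hR).symm
  · rcases hcases i hi with rfl | ⟨h1, h2⟩ | rfl | rfl
    · rw [hzero, Nat.cast_zero]; exact hw₀
    · exact hpre.mem i h1 h2
    · rw [hℓ1]; exact hRV hR
    · rw [hlast, hℓ0]; exact hw₀'

theorem card_le_transversalPathsBetween {V : Type*} [Fintype V] {G : SimpleGraph V} {t ℓ : ℕ}
    {Vs : ZMod t → Finset V} {w₀ w₀' : V} (S : Finset (ℕ → V))
    (hdef : ∀ w ∈ S, ∀ j, ℓ < j → w j = w₀')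
    (hpath : ∀ w ∈ S, w 0 = w₀ ∧ w ℓ = w₀' ∧
      (∀ i j, i ≤ ℓ → j ≤ ℓ → w i = w j → i = j ∨ (i = 0 ∧ j = ℓ) ∨ (i = ℓ ∧ j = 0)) ∧
      (∀ i, i < ℓ → G.Adj (w i) (w (i + 1))) ∧ ∀ i, i ≤ ℓ → w i ∈ Vs (i : ZMod t)) :
    S.card ≤ transversalPathsBetween G Vs ℓ w₀ w₀' := by
  unfold transversalPathsBetween
  rw [← Nat.card_eq_finsetCard S]
  refine Nat.card_le_card_of_injective
    (fun w : S => ⟨fun i : Fin (ℓ + 1) => w.1 i, ?_⟩) ?_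
  · obtain ⟨h1, h2, h3, h4, h5⟩ := hpath w.1 w.2
    refine ⟨by simpa using h1, by simpa using h2, fun i j he => ?_, fun i => ?_, fun i => ?_⟩
    · simp only [Fin.ext_iff, Fin.val_zero, Fin.val_last]
      exact h3 i j (by omega) (by omega) he
    · simpa using h4 i i.2
    · exact h5 i (by omega)
  · rintro ⟨w, hw⟩ ⟨w', hw'⟩ he
    simp only [Subtype.mk.injEq] at he ⊢
    funext j
    by_cases hj : j < ℓ + 1
    · exact congrFun he ⟨j, hj⟩
    · rw [hdef w hw j (by omega), hdef w' hw' j (by omega)]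

theorem stmt_3 {V : Type*} [Fintype V] (G : SimpleGraph V) (ε d : ℝ)
    (hε0 : 0 < ε) (hε : ε < (10 : ℝ) ^ (-5 : ℤ))
    (t n : ℕ) (ht : 2 ≤ t) (hn : ε⁻¹ ^ 2 ≤ (n : ℝ))
    (Vs : ZMod t → Finset V)
    (hdisj : ∀ i j : ZMod t, i ≠ j → Disjoint (Vs i) (Vs j))
    (hsize : ∀ i : ZMod t, n ≤ (Vs i).card)
    (hreg : ∀ i : ZMod t, IsRegularPair G ε (Vs i) (Vs (i + 1)))
    (hdens : ∀ i : ZMod t, d ≤ dens G (Vs i) (Vs (i + 1)))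
    (hd : 5 * Real.sqrt ε ≤ d)
    (ℓ : ℕ) (hdvd : t ∣ ℓ) (hℓ4 : 4 ≤ ℓ) (hℓ : (ℓ : ℝ) ≤ t * (1 - 3 * Real.sqrt ε) * n)
    (w₀ w₀' : V) (hw₀ : w₀ ∈ Vs 0) (hw₀' : w₀' ∈ Vs 0)
    (hdeg : (d - ε) * (Vs 1).card ≤ (((Vs 1).filter fun v => G.Adj w₀ v).card : ℝ))
    (hdeg' : (d - ε) * (Vs (-1)).card ≤ (((Vs (-1)).filter fun v => G.Adj w₀' v).card : ℝ)) :
    (d - 5 * Real.sqrt ε) ^ (ℓ - 1) * (1 - 2 * Real.sqrt ε) ^ (ℓ - 2) * (ε * n) *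
        ∏ i ∈ Finset.Icc 1 (ℓ - 2), ((n : ℝ) - (i / t : ℕ)) ≤
      (transversalPathsBetween G Vs ℓ w₀ w₀' : ℝ) := by
  set s := Real.sqrt ε
  have hs0 : 0 < s := Real.sqrt_pos.2 hε0
  have hsε : ε = s ^ 2 := (Real.sq_sqrt hε0.le).symm
  clear_value s
  subst hsε
  have hs : s < 1 / 300 := by
    have : s ^ 2 < (1 / 300) ^ 2 := hε.trans (by norm_num)
    exact lt_of_pow_lt_pow_left₀ 2 (by norm_num) this
  have hn1 : 300 ≤ s ^ 2 * n := by
    have h1 : s ^ 2 * ((s ^ 2)⁻¹ ^ 2) ≤ s ^ 2 * n := by gcongr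
    have h2 : s ^ 2 * ((s ^ 2)⁻¹ ^ 2) = (s ^ 2)⁻¹ := by field_simp
    have h3 : (300 : ℝ) ≤ (s ^ 2)⁻¹ := by
      rw [le_inv_comm₀ (by norm_num) (by positivity)]
      exact hε.le.trans (by norm_num)
    linarith
  have ht0 : 0 < t := by omega
  have hsize' : ∀ i, (n : ℝ) ≤ (Vs i).card := fun i => by exact_mod_cast hsize i
  have hbig : ∀ i, 300 ≤ s ^ 2 * (Vs i).card := fun i => hn1.trans (by gcongr; exact hsize i)
  have hpos : ∀ i, 0 < (Vs i).card := fun i => by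
    by_contra h
    have h0 : (Vs i).card = 0 := by omega
    have := hbig i
    rw [h0] at this
    norm_num at this
  have hs2 : ∀ i, 300 * (s ^ 2 * (Vs i).card) ≤ s * (Vs i).card := fun i => by
    have : 0 ≤ s * (Vs i).card := by positivity
    nlinarith
  have hℓ0 : (ℓ : ZMod t) = 0 := (ZMod.natCast_eq_zero_iff _ _).2 hdvd
  have hℓ1 : ((ℓ - 1 : ℕ) : ZMod t) = -1 := by
    rw [Nat.cast_sub (by omega), hℓ0]
    simp
  obtain ⟨R, hRsub, hRcard⟩ : ∃ R ⊆ (Vs (-1)).filter fun v => G.Adj w₀' v,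
      R.card = ⌈s ^ 2 * (Vs (-1)).card⌉₊ := by
    refine exists_subset_card_eq (Nat.ceil_le.2 (le_trans ?_ hdeg'))
    have h1 := hs2 (-1)
    have h2 : 5 * s * (Vs (-1)).card ≤ d * (Vs (-1)).card := by gcongr
    have h3 := hbig (-1)
    nlinarith
  have hRV : R ⊆ Vs (-1) := hRsub.trans (filter_subset _ _)
  have hRadj : ∀ x ∈ R, G.Adj w₀' x := fun x hx => (mem_filter.1 (hRsub hx)).2
  have hRge : s ^ 2 * (Vs (-1)).card ≤ R.card := by
    rw [hRcard]; exact Nat.le_ceil _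
  have hRle : (R.card : ℝ) ≤ s ^ 2 * (Vs (-1)).card + 1 := by
    rw [hRcard]; exact (Nat.ceil_lt_add_one (by positivity)).le
  have hR0 : 0 < R.card := by
    have : (0 : ℝ) < R.card := by linarith [hbig (-1)]
    exact_mod_cast this
  set F : Finset V := R ∪ {w₀, w₀'} with hF
  have hVF : ∀ i, ((Vs i ∩ F).card : ℝ) ≤ s ^ 2 * (Vs i).card + 3 := by
    intro i
    have h2 : ({w₀, w₀'} : Finset V).card ≤ 2 := card_le_two
    by_cases hi : i = -1
    · subst hi
      have h1 : (Vs (-1) ∩ F).card ≤ R.card + 2 :=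
        (card_le_card inter_subset_right).trans ((card_union_le _ _).trans (by omega))
      have h3 : ((Vs (-1) ∩ F).card : ℝ) ≤ R.card + 2 := by exact_mod_cast h1
      linarith
    · have h1 : Vs i ∩ F ⊆ {w₀, w₀'} := by
        intro y hy
        rw [mem_inter, hF, mem_union] at hy
        rcases hy.2 with h | h
        · exact absurd (hRV h) (disjoint_left.1 (hdisj _ _ hi) hy.1)
        · exact h
      have h3 : ((Vs i ∩ F).card : ℝ) ≤ 2 := by exact_mod_cast (card_le_card h1).trans h2
      linarith [hbig i]
  have hq : ∀ i, i ≤ ℓ → ((i / t : ℕ) : ℝ) ≤ (1 - 3 * s) * n := by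
    intro i hi
    have h1 : ((i / t : ℕ) : ℝ) ≤ (i : ℝ) / t := Nat.cast_div_le
    refine h1.trans ?_
    rw [div_le_iff₀ (by exact_mod_cast ht0)]
    have : (i : ℝ) ≤ ℓ := by exact_mod_cast hi
    linarith
  have havail : ∀ i k (w : ℕ → V), i ≤ ℓ → k < i →
      (∀ j, 1 ≤ j → j ≤ k → w j ∈ Vs (j : ZMod t)) →
      (1 - 2 * s) * ((n : ℝ) - (i / t : ℕ)) ≤ (avail Vs F i k w).card ∧
        s * (Vs (i : ZMod t)).card ≤ (avail Vs F i k w).card := by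
    intro i k w hi hki hw
    refine available_size_bounds hs0 hs (hsize' _) hn1 (hq i hi) ?_
    have h1 := card_avail_ge ht0 hdisj F hki hw
    have h2 : ((Vs (i : ZMod t)).card : ℝ) ≤ (avail Vs F i k w).card +
        (Vs (i : ZMod t) ∩ F).card + (i / t : ℕ) := by exact_mod_cast h1
    linarith [hVF i]
  have havail_sub : ∀ i k (w : ℕ → V), avail Vs F i k w ⊆ Vs (i : ZMod t) :=
    fun i k w => sdiff_subset
  have hd5 : 0 ≤ d - 5 * s := by linarith
  have hextend : ∀ k (w : ℕ → V) (B : Finset V), k + 1 ≤ ℓ →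
      IsGoodPrefix G Vs F w₀ (d - 2 * s) k w → B ⊆ Vs ((k + 2 : ℕ) : ZMod t) →
      s ^ 2 * (Vs ((k + 2 : ℕ) : ZMod t)).card ≤ B.card → 0 < B.card →
      ∃ C : Finset V, (d - 5 * s) * (1 - 2 * s) * ((n : ℝ) - ((k + 1) / t : ℕ)) ≤ C.card ∧
        ∀ x ∈ C, x ∈ avail Vs F (k + 1) k w ∧ G.Adj (w k) x ∧
          (d - s ^ 2) * B.card ≤ (B.filter fun v => G.Adj x v).card := by
    intro k w B hk hw hBsub hB hB0
    have hcast : ((k + 2 : ℕ) : ZMod t) = ((k + 1 : ℕ) : ZMod t) + 1 := by push_cast; ring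
    obtain ⟨hA1, hA2⟩ := havail (k + 1) k w hk (by omega) hw.1.mem
    rw [hcast] at hBsub hB
    obtain ⟨C, hC, hCx⟩ := exists_extension_set hs0 (hreg _) (hdens _) (hpos _) hBsub hB hB0
      (havail_sub (k + 1) k w) hA2 hw.2
    refine ⟨C, le_trans ?_ hC, hCx⟩
    rw [mul_assoc]
    gcongr
  have hgood : ∀ k, k + 3 ≤ ℓ → ∃ S : Finset (ℕ → V),
      ∏ i ∈ Icc 1 k, ((d - 5 * s) * (1 - 2 * s) * ((n : ℝ) - (i / t : ℕ))) ≤ S.card ∧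
      ∀ w ∈ S, IsGoodPrefix G Vs F w₀ (d - 2 * s) k w ∧ ∀ j, k < j → w j = w₀' := by
    intro k
    induction k with
    | zero =>
      intro _
      refine ⟨{Function.update (fun _ => w₀') 0 w₀}, by simp, fun w hw => ?_⟩
      rw [mem_singleton] at hw
      have hw0 : w 0 = w₀ := by rw [hw]; simp
      refine ⟨⟨⟨hw0, fun i _ _ => by omega, fun i _ _ => by omega, fun i j _ _ _ _ => by omega,
        fun i _ => by omega⟩, ?_⟩, fun j hj => ?_⟩
      · rw [hw0]
        have hAle : ((avail Vs F 1 0 w).card : ℝ) ≤ (Vs 1).card := by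
          have := card_le_card (havail_sub 1 0 w)
          rw [Nat.cast_one] at this
          exact_mod_cast this
        have hsub : ((Vs 1).filter fun v => G.Adj w₀ v) ⊆
            ((avail Vs F 1 0 w).filter fun v => G.Adj w₀ v) ∪ (Vs 1 ∩ F) := by
          intro y hy
          rw [mem_filter] at hy
          by_cases hyF : y ∈ F
          · exact mem_union_right _ (mem_inter.2 ⟨hy.1, hyF⟩)
          · refine mem_union_left _ (mem_filter.2 ⟨?_, hy.2⟩)
            simp [avail, hyF, hy.1]
        have h1 : (((Vs 1).filter fun v => G.Adj w₀ v).card : ℝ) ≤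
            ((avail Vs F 1 0 w).filter fun v => G.Adj w₀ v).card + (Vs 1 ∩ F).card := by
          exact_mod_cast (card_le_card hsub).trans (card_union_le _ _)
        have h2 := hVF 1
        have h3 := hs2 1
        have h4 := hbig 1
        have h5 : (d - 2 * s) * (avail Vs F 1 0 w).card ≤ (d - 2 * s) * (Vs 1).card := by
          apply mul_le_mul_of_nonneg_left hAle
          linarith
        simp only [zero_add]
        linarith
      · rw [hw, Function.update_of_ne (by omega)]
    | succ k ih =>
      intro hk
      obtain ⟨S, hS, hSw⟩ := ih (by omega)
      obtain ⟨S', hS', hSw'⟩ := exists_extension_family w₀' k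
        (IsGoodPrefix G Vs F w₀ (d - 2 * s) k) (IsGoodPrefix G Vs F w₀ (d - 2 * s) (k + 1))
        ((d - 5 * s) * (1 - 2 * s) * ((n : ℝ) - ((k + 1) / t : ℕ))) S hSw (by
          intro w hw
          have hB := (havail (k + 2) k w (by omega) (by omega) hw.1.mem).2
          have hB' : s ^ 2 * (Vs ((k + 2 : ℕ) : ZMod t)).card ≤ (avail Vs F (k + 2) k w).card := by
            linarith [hs2 ((k + 2 : ℕ) : ZMod t), hbig ((k + 2 : ℕ) : ZMod t)]
          obtain ⟨C, hC, hCx⟩ := hextend k w (avail Vs F (k + 2) k w) (by omega) hw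
            (havail_sub _ _ _) hB' (by
              have : (0 : ℝ) < (avail Vs F (k + 2) k w).card := by
                linarith [hbig ((k + 2 : ℕ) : ZMod t)]
              exact_mod_cast this)
          refine ⟨C, hC, fun x hx => ?_⟩
          obtain ⟨hxA, hxadj, hxB⟩ := hCx x hx
          refine ⟨hw.1.update hxA hxadj, ?_⟩
          rw [avail_update ht hdisj F k w (havail_sub _ _ _ hxA), Function.update_self]
          refine le_trans ?_ hxB
          gcongr
          nlinarith)
      refine ⟨S', le_trans ?_ hS', hSw'⟩
      rw [prod_Icc_succ_top (by omega)]
      have := hq (k + 1) (by omega)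
      have hn0 : (0 : ℝ) ≤ n := by positivity
      refine mul_le_mul_of_nonneg_right hS (mul_nonneg (mul_nonneg hd5 (by linarith)) ?_)
      nlinarith
  obtain ⟨m, rfl⟩ : ∃ m, ℓ = m + 3 := ⟨ℓ - 3, by omega⟩
  simp only [show m + 3 - 1 = m + 2 by omega,
    show m + 3 - 2 = m + 1 by omega] at hℓ1 ⊢
  obtain ⟨S₁, hS₁, hSw₁⟩ := hgood m le_rfl
  obtain ⟨S₂, hS₂, hSw₂⟩ := exists_extension_family w₀' m
    (IsGoodPrefix G Vs F w₀ (d - 2 * s) m)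
    (fun w => IsPrefix G Vs F w₀ (m + 1) w ∧
      (d - s ^ 2) * R.card ≤ (R.filter fun v => G.Adj (w (m + 1)) v).card)
    ((d - 5 * s) * (1 - 2 * s) * ((n : ℝ) - ((m + 1) / t : ℕ))) S₁ hSw₁ (by
      intro w hw
      obtain ⟨C, hC, hCx⟩ := hextend m w R (by omega) hw (by rw [hℓ1]; exact hRV)
        (by rw [hℓ1]; exact hRge) hR0
      refine ⟨C, hC, fun x hx => ?_⟩
      obtain ⟨hxA, hxadj, hxB⟩ := hCx x hx
      refine ⟨hw.1.update hxA hxadj, ?_⟩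
      rw [Function.update_self]
      exact hxB)
  obtain ⟨S₃, hS₃, hSw₃⟩ := exists_extension_family w₀' (m + 1)
    (fun w => IsPrefix G Vs F w₀ (m + 1) w ∧
      (d - s ^ 2) * R.card ≤ (R.filter fun v => G.Adj (w (m + 1)) v).card)
    (fun w => IsPrefix G Vs F w₀ (m + 1) w ∧ w (m + 2) ∈ R ∧ G.Adj (w (m + 1)) (w (m + 2)))
    ((d - 5 * s) * (s ^ 2 * n)) S₂ hSw₂ (by
      intro w hw
      refine ⟨R.filter fun v => G.Adj (w (m + 1)) v, le_trans ?_ hw.2, fun x hx => ?_⟩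
      · have h1 : s ^ 2 * n ≤ R.card := le_trans (by gcongr; exact hsize _) hRge
        have h2 : d - 5 * s ≤ d - s ^ 2 := by nlinarith
        exact mul_le_mul h2 h1 (by positivity) (by linarith)
      · rw [mem_filter] at hx
        have hne : ∀ i, i ≤ m + 1 → Function.update w (m + 1 + 1) x i = w i := fun i hi =>
          Function.update_of_ne (by omega) _ _
        have hself : Function.update w (m + 1 + 1) x (m + 2) = x := Function.update_self _ _ _
        refine ⟨⟨?_, fun i h1 hi => ?_, fun i h1 hi => ?_, fun i j hi1 hi hj1 hj he => ?_,
          fun i hi => ?_⟩, ?_, ?_⟩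
        · rw [hne 0 (by omega)]; exact hw.1.zero
        · rw [hne i hi]; exact hw.1.mem i h1 hi
        · rw [hne i hi]; exact hw.1.avoid i h1 hi
        · rw [hne i hi, hne j hj] at he
          exact hw.1.inj i j hi1 hi hj1 hj he
        · rw [hne i hi.le, hne (i + 1) hi]; exact hw.1.adj i hi
        · rw [hself]; exact hx.1
        · rw [hself, hne _ le_rfl]; exact hx.2)
  have hcard : (d - 5 * s) ^ (m + 2) * (1 - 2 * s) ^ (m + 1) * (s ^ 2 * n) *
      ∏ i ∈ Icc 1 (m + 1), ((n : ℝ) - (i / t : ℕ)) ≤ S₃.card := by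
    have hfac : ∀ i, i ≤ m + 3 → 0 ≤ (d - 5 * s) * (1 - 2 * s) * ((n : ℝ) - (i / t : ℕ)) := by
      intro i hi
      have := hq i hi
      have hn0 : (0 : ℝ) ≤ n := by positivity
      refine mul_nonneg (mul_nonneg hd5 (by linarith)) ?_
      nlinarith
    have h1 : ∏ i ∈ Icc 1 (m + 1), ((d - 5 * s) * (1 - 2 * s) * ((n : ℝ) - (i / t : ℕ))) ≤
        S₂.card := by
      rw [prod_Icc_succ_top (by omega)]
      exact (mul_le_mul_of_nonneg_right hS₁ (hfac _ (by omega))).trans hS₂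
    have h2 := (mul_le_mul_of_nonneg_right h1
      (mul_nonneg hd5 (by positivity : 0 ≤ s ^ 2 * (n : ℝ)))).trans hS₃
    rw [prod_mul_distrib, prod_const, Nat.card_Icc, Nat.add_sub_cancel, mul_pow] at h2
    refine le_trans (le_of_eq ?_) h2
    ring
  refine hcard.trans ?_
  norm_cast
  refine card_le_transversalPathsBetween S₃ (fun w hw j hj => (hSw₃ w hw).2 j (by omega))
    fun w hw => ?_
  obtain ⟨⟨hpre, hR, hadj⟩, hdef⟩ := hSw₃ w hw
  exact hpre.close ht hdisj hℓ0 hℓ1 hw₀ hw₀' hRV hRadj hR hadj (hdef _ (by omega))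
end
end
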